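/- arXiv:1502.07656 — 4 statements merged into one kernel-verified Lean document; each statement's English description precedes it below -/
import Mathlib

section
/- For all j, k, l ∈ {1,…,m+n} and all ξ, η, ε ∈ {+1,−1}, the matrices c_j^± satisfy the triple relation ⟦⟦c_j^ξ, c_k^η⟧, c_l^ε⟧ = −2 δ_{jl} δ_{ε,−ξ} ε^{⟨l⟩} (−1)^{⟨k⟩⟨l⟩} c_k^η + 2 ε^{⟨l⟩} δ_{kl} δ_{ε,−η} c_j^ξ, where ε^{⟨l⟩} equals 1 if l ≤ m and equals ε if l > m, the inner bracket ⟦c_j^ξ, c_k^η⟧ is taken with parities ⟨j⟩, ⟨k⟩, and the outer bracket is taken with parities ⟨j⟩+⟨k⟩ mod 2 and ⟨l⟩. -/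
/- Setup: the Lie superalgebra osp(2m+1|2n) realized by matrices, with the
   2m+2n generators `c_j^±` and their triple relations. -/

noncomputable section

/-- `matE m n i j` is the `N×N` complex matrix (`N = 2m+2n+1`) with a `1` in
(1-based) position `(i,j)` and zeros elsewhere. -/
def matE (m n : ℕ) (i j : ℕ) : Matrix (Fin (2*m+2*n+1)) (Fin (2*m+2*n+1)) ℂ :=
  Matrix.of fun a b => if a.val + 1 = i ∧ b.val + 1 = j then 1 else 0

/-- The generators `c_j^s` (1-based index `j ∈ {1,…,m+n}`, sign `s ∈ {1,-1}`). -/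
def cgen (m n : ℕ) (j : ℕ) (s : ℤ) : Matrix (Fin (2*m+2*n+1)) (Fin (2*m+2*n+1)) ℂ :=
  if j ≤ m then
    if s = 1 then
      (Real.sqrt 2 : ℂ) • (matE m n j (2*m+1) - matE m n (2*m+1) (j+m))
    else
      (Real.sqrt 2 : ℂ) • (matE m n (2*m+1) j - matE m n (j+m) (2*m+1))
  else
    if s = 1 then
      (Real.sqrt 2 : ℂ) • (matE m n (2*m+1) (2*m+1+n+(j-m)) + matE m n (2*m+1+(j-m)) (2*m+1))
    else
      (Real.sqrt 2 : ℂ) • (matE m n (2*m+1) (2*m+1+(j-m)) - matE m n (2*m+1+n+(j-m)) (2*m+1))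

/-- The parity `⟨j⟩` of the generator `c_j^±`: `0` for `j ≤ m`, `1` for `j > m`. -/
def par (m : ℕ) (j : ℕ) : ℕ := if j ≤ m then 0 else 1

/-- The super bracket `⟦A,B⟧ = AB - (-1)^{ab} BA` of matrices `A`, `B` carrying
parities `a`, `b` (in `{0,1}`). -/
def sbr (m n : ℕ) (a b : ℕ) (A B : Matrix (Fin (2*m+2*n+1)) (Fin (2*m+2*n+1)) ℂ) :
    Matrix (Fin (2*m+2*n+1)) (Fin (2*m+2*n+1)) ℂ :=
  A * B - ((-1 : ℂ)^(a*b)) • (B * A)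

lemma matE_mul (m n i j k l : ℕ) (h1 : 1 ≤ j) (h2 : j ≤ 2*m+2*n+1) :
    matE m n i j * matE m n k l = (if j = k then (1:ℂ) else 0) • matE m n i l := by
  ext a b
  simp only [matE, Matrix.mul_apply, Matrix.of_apply, Matrix.smul_apply]
  rw [Finset.sum_eq_single (⟨j-1, by omega⟩ : Fin (2*m+2*n+1))]
  · have : j - 1 + 1 = j := by omega
    simp only [this]
    by_cases h : j = k <;> by_cases ha : a.val + 1 = i <;> by_cases hb : b.val + 1 = l <;>
      simp [h, ha, hb]
  · intro c _ hc
    have : ¬ (c.val + 1 = j) := by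
      intro h
      apply hc
      ext
      simp
      omega
    simp [this]
  · simp

def gP (m n j : ℕ) (s : ℤ) : ℕ :=
  if j ≤ m then (if s = 1 then j else j + m)
  else (if s = 1 then 2*m+1+(j-m) else 2*m+1+n+(j-m))

def gQ (m n j : ℕ) (s : ℤ) : ℕ :=
  if j ≤ m then (if s = 1 then j + m else j)
  else (if s = 1 then 2*m+1+n+(j-m) else 2*m+1+(j-m))

def gA (s : ℤ) : ℂ := if s = 1 then 1 else -1

def gB (m j : ℕ) (s : ℤ) : ℂ := if j ≤ m then (if s = 1 then -1 else 1) else 1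

def gG (m n j k : ℕ) (s t : ℤ) : ℂ :=
  gB m j s * gA t * (if gQ m n j s = gP m n k t then 1 else 0)

lemma cgen_eq (m n j : ℕ) (s : ℤ) : cgen m n j s =
    (Real.sqrt 2 : ℂ) • (gA s • matE m n (gP m n j s) (2*m+1)
      + gB m j s • matE m n (2*m+1) (gQ m n j s)) := by
  unfold cgen gA gB gP gQ
  split_ifs <;> simp [sub_eq_add_neg, add_comm]

lemma gG_eq (m n j k : ℕ) (s t : ℤ) (hj : 1 ≤ j ∧ j ≤ m + n) (hk : 1 ≤ k ∧ k ≤ m + n)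
    (hs : s = 1 ∨ s = -1) (ht : t = 1 ∨ t = -1) :
    gG m n j k s t = if j = k ∧ t = -s then (((if k ≤ m then 1 else t : ℤ)) : ℂ) else 0 := by
  have key : gQ m n j s = gP m n k t ↔ (j = k ∧ t = -s) := by
    unfold gQ gP
    rcases hs with rfl | rfl <;> rcases ht with rfl | rfl <;> simp <;> split_ifs <;> omega
  unfold gG
  simp only [key]
  by_cases h : j = k ∧ t = -s
  · obtain ⟨rfl, rfl⟩ := h
    unfold gA gB
    rcases hs with rfl | rfl <;> by_cases h : j ≤ m <;> simp [h]
  · simp [h]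

lemma cgen_mul (m n j k : ℕ) (s t : ℤ) (hj : 1 ≤ j ∧ j ≤ m + n) (hk : 1 ≤ k ∧ k ≤ m + n) :
    cgen m n j s * cgen m n k t = (2:ℂ) • ((gA s * gB m k t) •
      matE m n (gP m n j s) (gQ m n k t) + gG m n j k s t • matE m n (2*m+1) (2*m+1)) := by
  have hQ : 1 ≤ gQ m n j s ∧ gQ m n j s ≤ 2*m+2*n+1 ∧ gQ m n j s ≠ 2*m+1 := by
    unfold gQ; split_ifs <;> omega
  have hP : 2*m+1 ≠ gP m n k t := by
    unfold gP; split_ifs <;> omega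
  have h2 : (Real.sqrt 2 : ℂ) * (Real.sqrt 2 : ℂ) = 2 := by
    norm_cast; simp
  rw [cgen_eq, cgen_eq, smul_mul_smul_comm, h2]
  congr 1
  simp only [add_mul, mul_add, smul_mul_smul_comm, matE_mul m n _ _ _ _ hQ.1 hQ.2.1,
    matE_mul m n _ (2*m+1) _ _ (by omega) (by omega), if_neg hQ.2.2, if_neg hP, if_true,
    zero_smul, smul_zero, one_smul, gG, smul_smul, zero_add, add_zero]
  abel

lemma E_mul_cgen (m n p k l : ℕ) (s t : ℤ) (hk : 1 ≤ k ∧ k ≤ m + n) :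
    (gB m k s • matE m n p (gQ m n k s)) * cgen m n l t =
      ((Real.sqrt 2 : ℂ) * gG m n k l s t) • matE m n p (2*m+1) := by
  have hQ : 1 ≤ gQ m n k s ∧ gQ m n k s ≤ 2*m+2*n+1 ∧ gQ m n k s ≠ 2*m+1 := by
    unfold gQ; split_ifs <;> omega
  rw [cgen_eq]
  simp only [mul_add, mul_smul_comm, smul_mul_assoc, smul_add, matE_mul m n _ _ _ _ hQ.1 hQ.2.1,
    if_neg hQ.2.2, zero_smul, smul_zero, add_zero, smul_smul, gG]
  congr 1
  ring

lemma cgen_mul_E (m n q k l : ℕ) (s t : ℤ) (hk : 1 ≤ k ∧ k ≤ m + n) (hl : 1 ≤ l ∧ l ≤ m + n) :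
    cgen m n l t * (gA s • matE m n (gP m n k s) q) =
      ((Real.sqrt 2 : ℂ) * gG m n l k t s) • matE m n (2*m+1) q := by
  have hQ : 1 ≤ gQ m n l t ∧ gQ m n l t ≤ 2*m+2*n+1 ∧ gQ m n l t ≠ 2*m+1 := by
    unfold gQ; split_ifs <;> omega
  have hP : 2*m+1 ≠ gP m n k s := by
    unfold gP; split_ifs <;> omega
  rw [cgen_eq]
  simp only [add_mul, mul_smul_comm, smul_mul_assoc, smul_add, matE_mul m n _ _ _ _ hQ.1 hQ.2.1,
    matE_mul m n _ (2*m+1) _ _ (by omega) (by omega),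
    if_neg hP, zero_smul, smul_zero, zero_add, smul_smul, gG]
  congr 1
  ring

lemma core (m n j k l : ℕ) (x y e : ℤ) (hj : 1 ≤ j ∧ j ≤ m + n) (hk : 1 ≤ k ∧ k ≤ m + n)
    (hl : 1 ≤ l ∧ l ≤ m + n) (σ τ : ℂ)
    (h1 : gG m n j k x y = σ * gG m n k j y x)
    (h2 : τ * σ * gG m n l k e y = gG m n k l y e)
    (h3 : τ * gG m n l j e x = σ * gG m n j l x e) :
    (cgen m n j x * cgen m n k y - σ • (cgen m n k y * cgen m n j x)) * cgen m n l e
      - τ • (cgen m n l e * (cgen m n j x * cgen m n k y - σ • (cgen m n k y * cgen m n j x)))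
    = (-2 * σ * gG m n j l x e) • cgen m n k y + (2 * gG m n k l y e) • cgen m n j x := by
  have hb : cgen m n j x * cgen m n k y - σ • (cgen m n k y * cgen m n j x)
      = (2 * gA x) • (gB m k y • matE m n (gP m n j x) (gQ m n k y))
        - (2 * σ * gA y) • (gB m j x • matE m n (gP m n k y) (gQ m n j x)) := by
    rw [cgen_mul m n j k x y hj hk, cgen_mul m n k j y x hk hj, h1]
    module
  have hb' : cgen m n j x * cgen m n k y - σ • (cgen m n k y * cgen m n j x)
      = (2 * gB m k y) • (gA x • matE m n (gP m n j x) (gQ m n k y))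
        - (2 * σ * gB m j x) • (gA y • matE m n (gP m n k y) (gQ m n j x)) := by
    rw [hb]
    module
  have e1 : (cgen m n j x * cgen m n k y - σ • (cgen m n k y * cgen m n j x)) * cgen m n l e
      = (2 * gA x * ((Real.sqrt 2 : ℂ) * gG m n k l y e)) • matE m n (gP m n j x) (2*m+1)
       - (2 * σ * gA y * ((Real.sqrt 2 : ℂ) * gG m n j l x e)) •
          matE m n (gP m n k y) (2*m+1) := by
    rw [hb, sub_mul, smul_mul_assoc (2 * gA x), smul_mul_assoc (2 * σ * gA y), E_mul_cgen m n _ k l y e hk,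
      E_mul_cgen m n _ j l x e hj, smul_smul, smul_smul]
  have e2 : τ • (cgen m n l e *
        (cgen m n j x * cgen m n k y - σ • (cgen m n k y * cgen m n j x)))
      = (2 * gB m k y * ((Real.sqrt 2 : ℂ) * (τ * gG m n l j e x))) •
          matE m n (2*m+1) (gQ m n k y)
       - (2 * gB m j x * ((Real.sqrt 2 : ℂ) * (τ * σ * gG m n l k e y))) •
          matE m n (2*m+1) (gQ m n j x) := by
    rw [hb', mul_sub, mul_smul_comm (2 * gB m k y), mul_smul_comm (2 * σ * gB m j x), cgen_mul_E m n _ j l x e hj hl,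
      cgen_mul_E m n _ k l y e hk hl]
    module
  rw [e1, e2, h2, h3, cgen_eq m n j x, cgen_eq m n k y]
  module

/-- the triple relations
`⟦⟦c_j^ξ, c_k^η⟧, c_l^ε⟧ = -2 δ_{jl} δ_{ε,-ξ} ε^{⟨l⟩} (-1)^{⟨k⟩⟨l⟩} c_k^η
  + 2 ε^{⟨l⟩} δ_{kl} δ_{ε,-η} c_j^ξ`. -/
theorem osp_triple_relations (m n : ℕ) (hm : 0 < m) (hn : 0 < n)
    (j k l : ℕ) (hj : j ∈ Finset.Icc 1 (m+n)) (hk : k ∈ Finset.Icc 1 (m+n))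
    (hl : l ∈ Finset.Icc 1 (m+n))
    (ξ η ε : ℤ) (hξ : ξ = 1 ∨ ξ = -1) (hη : η = 1 ∨ η = -1) (hε : ε = 1 ∨ ε = -1) :
    sbr m n ((par m j + par m k) % 2) (par m l)
      (sbr m n (par m j) (par m k) (cgen m n j ξ) (cgen m n k η)) (cgen m n l ε)
    = ((-2 : ℂ) * (if j = l then 1 else 0) * (if ε = -ξ then 1 else 0)
          * (((if l ≤ m then 1 else ε : ℤ) : ℂ))
          * (-1 : ℂ)^(par m k * par m l)) • cgen m n k η
      + ((2 : ℂ) * (((if l ≤ m then 1 else ε : ℤ) : ℂ))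
          * (if k = l then 1 else 0) * (if ε = -η then 1 else 0)) • cgen m n j ξ := by
  rw [Finset.mem_Icc] at hj hk hl
  have hc := core m n j k l ξ η ε hj hk hl ((-1)^(par m j * par m k))
    ((-1)^((par m j + par m k) % 2 * par m l))
    (by
      rw [gG_eq m n j k ξ η hj hk hξ hη, gG_eq m n k j η ξ hk hj hη hξ]
      by_cases h : j = k ∧ η = -ξ
      · obtain ⟨rfl, rfl⟩ := h
        by_cases h : j ≤ m <;> simp [par, h]
      · have h' : ¬ (k = j ∧ ξ = -η) := by omega
        simp [h, h'])
    (by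
      rw [gG_eq m n l k ε η hl hk hε hη, gG_eq m n k l η ε hk hl hη hε]
      by_cases h : k = l ∧ ε = -η
      · obtain ⟨rfl, rfl⟩ := h
        by_cases h : k ≤ m <;> by_cases h' : j ≤ m <;> simp [par, h, h']
      · have h' : ¬ (l = k ∧ η = -ε) := by omega
        simp [h, h'])
    (by
      rw [gG_eq m n l j ε ξ hl hj hε hξ, gG_eq m n j l ξ ε hj hl hξ hε]
      by_cases h : j = l ∧ ε = -ξ
      · obtain ⟨rfl, rfl⟩ := h
        by_cases h : j ≤ m <;> by_cases h' : k ≤ m <;> simp [par, h, h']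
      · have h' : ¬ (l = j ∧ ξ = -ε) := by omega
        simp [h, h'])
  unfold sbr
  rw [hc, gG_eq m n j l ξ ε hj hl hξ hε, gG_eq m n k l η ε hk hl hη hε]
  congr 2
  · by_cases h : j = l
    · subst h
      by_cases h' : ε = -ξ
      · simp only [h', and_self, if_true]
        rw [mul_comm (par m j)]
        ring
      · simp [h']
    · simp [h]
  · by_cases h : k = l <;> by_cases h' : ε = -η <;> simp [h, h']

end
end

section
/- The complex linear span of the set of matrices consisting of the commutators [c_i^ξ, c_k^η] for 1 ≤ i, k ≤ m and ξ, η ∈ {+1,−1}, the matrices c_l^ε for 1 ≤ l ≤ m and ε ∈ {+1,−1}, and the anticommutators {c_{m+j}^ξ, c_{m+s}^η} for 1 ≤ j, s ≤ n and ξ, η ∈ {+1,−1}, equals the space of N×N complex matrices X that vanish outside the union of the leading (2m+1)×(2m+1) diagonal block X₁ and the trailing 2n×2n diagonal block X₂, and whose blocks satisfy X₁ᵀG₁ + G₁X₁ = 0 and X₂ᵀG₂ + G₂X₂ = 0, where G₁ is the symmetric (2m+1)×(2m+1) matrix with block form [[0, I_m, 0],[I_m, 0, 0],[0, 0, 1]]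 and G₂ is the skew-symmetric 2n×2n matrix [[0, I_n],[−I_n, 0]]. (This space is the even subalgebra so(2m+1) ⊕ sp(2n) of osp(2m+1|2n).) -/
/- Setup: the generators `c_j^±` of osp(2m+1|2n) realized as matrices, and the
even subalgebra so(2m+1) ⊕ sp(2n). -/

open Matrix

noncomputable section

/-- The spanning set: commutators `[c_i^ξ, c_k^η]` (1 ≤ i,k ≤ m), the `c_l^ε`
(1 ≤ l ≤ m), and anticommutators `{c_{m+j}^ξ, c_{m+s}^η}` (1 ≤ j,s ≤ n). -/
def evenGens (m n : ℕ) : Set (Matrix (Fin (2*m+2*n+1)) (Fin (2*m+2*n+1)) ℂ) :=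
  {A | ∃ i k : ℕ, ∃ ξ η : ℤ, i ∈ Finset.Icc 1 m ∧ k ∈ Finset.Icc 1 m ∧
        (ξ = 1 ∨ ξ = -1) ∧ (η = 1 ∨ η = -1) ∧
        A = cgen m n i ξ * cgen m n k η - cgen m n k η * cgen m n i ξ}
  ∪ {A | ∃ l : ℕ, ∃ ε : ℤ, l ∈ Finset.Icc 1 m ∧ (ε = 1 ∨ ε = -1) ∧ A = cgen m n l ε}
  ∪ {A | ∃ j s : ℕ, ∃ ξ η : ℤ, j ∈ Finset.Icc 1 n ∧ s ∈ Finset.Icc 1 n ∧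
        (ξ = 1 ∨ ξ = -1) ∧ (η = 1 ∨ η = -1) ∧
        A = cgen m n (m+j) ξ * cgen m n (m+s) η + cgen m n (m+s) η * cgen m n (m+j) ξ}

/-- The symmetric matrix `G₁ = [[0, I_m, 0], [I_m, 0, 0], [0, 0, 1]]`. -/
def G1 (m : ℕ) : Matrix (Fin (2*m+1)) (Fin (2*m+1)) ℂ :=
  Matrix.of fun a b =>
    if (a.val < m ∧ b.val = a.val + m) ∨ (b.val < m ∧ a.val = b.val + m)
        ∨ (a.val = 2*m ∧ b.val = 2*m) then 1 else 0

/-- The skew-symmetric matrix `G₂ = [[0, I_n], [-I_n, 0]]`. -/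
def G2 (n : ℕ) : Matrix (Fin (2*n)) (Fin (2*n)) ℂ :=
  Matrix.of fun a b =>
    if a.val < n ∧ b.val = a.val + n then 1
    else if b.val < n ∧ a.val = b.val + n then -1 else 0

/-- The leading `(2m+1)×(2m+1)` diagonal block of an `N×N` matrix. -/
def block1 (m n : ℕ) (X : Matrix (Fin (2*m+2*n+1)) (Fin (2*m+2*n+1)) ℂ) :
    Matrix (Fin (2*m+1)) (Fin (2*m+1)) ℂ :=
  Matrix.of fun a b => X ⟨a.val, by have := a.isLt; omega⟩ ⟨b.val, by have := b.isLt; omega⟩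

/-- The trailing `2n×2n` diagonal block of an `N×N` matrix. -/
def block2 (m n : ℕ) (X : Matrix (Fin (2*m+2*n+1)) (Fin (2*m+2*n+1)) ℂ) :
    Matrix (Fin (2*n)) (Fin (2*n)) ℂ :=
  Matrix.of fun a b =>
    X ⟨2*m+1+a.val, by have := a.isLt; omega⟩ ⟨2*m+1+b.val, by have := b.isLt; omega⟩

/-- The even subalgebra so(2m+1) ⊕ sp(2n) as a set of block-diagonal matrices. -/
def evenTarget (m n : ℕ) : Set (Matrix (Fin (2*m+2*n+1)) (Fin (2*m+2*n+1)) ℂ) :=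
  {X | (∀ a b : Fin (2*m+2*n+1),
          ((a.val < 2*m+1 ∧ ¬ b.val < 2*m+1) ∨ (¬ a.val < 2*m+1 ∧ b.val < 2*m+1)) →
          X a b = 0) ∧
       (block1 m n X)ᵀ * G1 m + G1 m * block1 m n X = 0 ∧
       (block2 m n X)ᵀ * G2 n + G2 n * block2 m n X = 0}


theorem matE_mul_eq (m n i j l : ℕ) (h1 : 1 ≤ j) (h2 : j ≤ 2*m+2*n+1) :
    matE m n i j * matE m n j l = matE m n i l := by
  ext a b
  simp only [matE, Matrix.mul_apply, Matrix.of_apply]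
  rw [Finset.sum_eq_single (⟨j-1, by omega⟩ : Fin (2*m+2*n+1))]
  · have : j - 1 + 1 = j := by omega
    simp only [this]
    by_cases ha : a.val + 1 = i <;> by_cases hb : b.val + 1 = l <;> simp [ha, hb]
  · intro c _ hc
    have : c.val + 1 ≠ j := fun h => hc (Fin.ext (by simp; omega))
    simp [this]
  · simp

theorem matE_mul_ne (m n i j k l : ℕ) (h : j ≠ k) :
    matE m n i j * matE m n k l = 0 := by
  ext a b
  simp only [matE, Matrix.mul_apply, Matrix.of_apply, Matrix.zero_apply]
  apply Finset.sum_eq_zero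
  intro c _
  by_cases hc : c.val + 1 = j
  · have : c.val + 1 ≠ k := by omega
    simp [this]
  · simp [hc]

theorem sqrt_two_mul : (Real.sqrt 2 : ℂ) * (Real.sqrt 2 : ℂ) = 2 := by
  rw [← Complex.ofReal_mul, Real.mul_self_sqrt (by norm_num)]; norm_num

theorem comm_pp (m n i k : ℕ) (hi : 1 ≤ i) (hi' : i ≤ m) (hk : 1 ≤ k) (hk' : k ≤ m) :
    cgen m n i 1 * cgen m n k 1 - cgen m n k 1 * cgen m n i 1
      = (2:ℂ) • (matE m n k (i+m) - matE m n i (k+m)) := by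
  simp only [cgen, hi', hk', if_true, smul_mul_smul_comm, sqrt_two_mul, sub_mul, mul_sub]
  simp (disch := omega) only [matE_mul_eq, matE_mul_ne]
  module

theorem comm_pm (m n i k : ℕ) (hi : 1 ≤ i) (hi' : i ≤ m) (hk : 1 ≤ k) (hk' : k ≤ m) :
    cgen m n i 1 * cgen m n k (-1) - cgen m n k (-1) * cgen m n i 1
      = (2:ℂ) • (matE m n i k - matE m n (k+m) (i+m)) := by
  simp only [cgen, hi', hk', if_true, smul_mul_smul_comm, sqrt_two_mul, sub_mul, mul_sub,
    show ((-1:ℤ) = 1) = False by simp, if_false]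
  by_cases h : i = k
  · subst h
    simp (disch := omega) only [matE_mul_eq, matE_mul_ne]
    module
  · simp (disch := omega) only [matE_mul_eq, matE_mul_ne]
    module

theorem comm_mm (m n i k : ℕ) (hi : 1 ≤ i) (hi' : i ≤ m) (hk : 1 ≤ k) (hk' : k ≤ m) :
    cgen m n i (-1) * cgen m n k (-1) - cgen m n k (-1) * cgen m n i (-1)
      = (2:ℂ) • (matE m n (k+m) i - matE m n (i+m) k) := by
  simp only [cgen, hi', hk', if_true, smul_mul_smul_comm, sqrt_two_mul, sub_mul, mul_sub,
    show ((-1:ℤ) = 1) = False by simp, if_false]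
  simp (disch := omega) only [matE_mul_eq, matE_mul_ne]
  module

theorem anti_pp (m n i k : ℕ) (hi : 1 ≤ i) (hi' : i ≤ n) (hk : 1 ≤ k) (hk' : k ≤ n) :
    cgen m n (m+i) 1 * cgen m n (m+k) 1 + cgen m n (m+k) 1 * cgen m n (m+i) 1
      = (2:ℂ) • (matE m n (2*m+1+i) (2*m+1+n+k) + matE m n (2*m+1+k) (2*m+1+n+i)) := by
  simp only [cgen, show ¬ (m + i ≤ m) by omega, show ¬ (m + k ≤ m) by omega, if_true, if_false,
    smul_mul_smul_comm, sqrt_two_mul, sub_mul, mul_sub, add_mul, mul_add, Nat.add_sub_cancel_left]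
  simp (disch := omega) only [matE_mul_eq, matE_mul_ne]
  module

theorem anti_pm (m n i k : ℕ) (hi : 1 ≤ i) (hi' : i ≤ n) (hk : 1 ≤ k) (hk' : k ≤ n) :
    cgen m n (m+i) 1 * cgen m n (m+k) (-1) + cgen m n (m+k) (-1) * cgen m n (m+i) 1
      = (2:ℂ) • (matE m n (2*m+1+i) (2*m+1+k) - matE m n (2*m+1+n+k) (2*m+1+n+i)) := by
  simp only [cgen, show ¬ (m + i ≤ m) by omega, show ¬ (m + k ≤ m) by omega, if_true, if_false,
    smul_mul_smul_comm, sqrt_two_mul, sub_mul, mul_sub, add_mul, mul_add, Nat.add_sub_cancel_left,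
    show ((-1:ℤ) = 1) = False by simp]
  by_cases h : i = k
  · subst h
    simp (disch := omega) only [matE_mul_eq, matE_mul_ne]
    module
  · simp (disch := omega) only [matE_mul_eq, matE_mul_ne]
    module

theorem anti_mm (m n i k : ℕ) (hi : 1 ≤ i) (hi' : i ≤ n) (hk : 1 ≤ k) (hk' : k ≤ n) :
    cgen m n (m+i) (-1) * cgen m n (m+k) (-1) + cgen m n (m+k) (-1) * cgen m n (m+i) (-1)
      = (-2:ℂ) • (matE m n (2*m+1+n+i) (2*m+1+k) + matE m n (2*m+1+n+k) (2*m+1+i)) := by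
  simp only [cgen, show ¬ (m + i ≤ m) by omega, show ¬ (m + k ≤ m) by omega, if_true, if_false,
    smul_mul_smul_comm, sqrt_two_mul, sub_mul, mul_sub, add_mul, mul_add, Nat.add_sub_cancel_left,
    show ((-1:ℤ) = 1) = False by simp]
  simp (disch := omega) only [matE_mul_eq, matE_mul_ne]
  module

/-- The index involution (0-based). -/
def sg (m n a : ℕ) : ℕ :=
  if a < m then a + m else if a < 2*m then a - m else if a = 2*m then a
  else if a < 2*m+1+n then a + n else a - n

/-- The sign attached to an index. -/
def tg (m n a : ℕ) : ℂ := if a < 2*m+1+n then 1 else -1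

theorem sg_lt (m n a : ℕ) (h : a < 2*m+2*n+1) : sg m n a < 2*m+2*n+1 := by
  unfold sg; split_ifs <;> omega

/-- The index involution on `Fin N`. -/
def sF (m n : ℕ) (a : Fin (2*m+2*n+1)) : Fin (2*m+2*n+1) := ⟨sg m n a, sg_lt m n a a.isLt⟩

/-- Entrywise form of membership in the even subalgebra. -/
def evenP (m n : ℕ) (X : Matrix (Fin (2*m+2*n+1)) (Fin (2*m+2*n+1)) ℂ) : Prop :=
  (∀ a b : Fin (2*m+2*n+1),
          ((a.val < 2*m+1 ∧ ¬ b.val < 2*m+1) ∨ (¬ a.val < 2*m+1 ∧ b.val < 2*m+1)) →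
          X a b = 0) ∧
  ∀ a b, X a b = - (tg m n a * tg m n b) * X (sF m n b) (sF m n a)

theorem sg1_lt (m n a : ℕ) (h : a < 2*m+1) : sg m n a < 2*m+1 := by
  unfold sg; split_ifs <;> omega

theorem sg2_lt (m n a : ℕ) (h : a < 2*n) : sg m n (2*m+1+a) - (2*m+1) < 2*n := by
  unfold sg; split_ifs <;> omega

theorem G1_left (m n : ℕ) (k b : Fin (2*m+1)) :
    G1 m k b = if k = ⟨sg m n b, sg1_lt m n b b.isLt⟩ then 1 else 0 := by
  have := k.isLt
  have := b.isLt
  simp only [G1, Matrix.of_apply, Fin.ext_iff]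
  congr 1
  simp only [sg]
  apply propext
  split_ifs <;> omega

theorem G1_right (m n : ℕ) (k b : Fin (2*m+1)) :
    G1 m b k = if k = ⟨sg m n b, sg1_lt m n b b.isLt⟩ then 1 else 0 := by
  rw [← G1_left]
  simp only [G1, Matrix.of_apply]
  congr 1
  apply propext
  omega

theorem G2_right (m n : ℕ) (k b : Fin (2*n)) :
    G2 n b k = if k = ⟨sg m n (2*m+1+b) - (2*m+1), sg2_lt m n b b.isLt⟩
      then tg m n (2*m+1+b) else 0 := by
  have := k.isLt
  have := b.isLt
  simp only [G2, Matrix.of_apply, Fin.ext_iff, sg, tg]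
  split_ifs <;> first | rfl | omega

theorem G2_left (m n : ℕ) (k b : Fin (2*n)) :
    G2 n k b = if k = ⟨sg m n (2*m+1+b) - (2*m+1), sg2_lt m n b b.isLt⟩
      then -tg m n (2*m+1+b) else 0 := by
  have := k.isLt
  have := b.isLt
  simp only [G2, Matrix.of_apply, Fin.ext_iff, sg, tg]
  split_ifs <;> first | rfl | omega | simp

theorem eq1_entry (m n : ℕ) (X : Matrix (Fin (2*m+2*n+1)) (Fin (2*m+2*n+1)) ℂ)
    (a b : Fin (2*m+1)) :
    ((block1 m n X)ᵀ * G1 m + G1 m * block1 m n X) a b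
      = X (sF m n ⟨b, by omega⟩) ⟨a, by omega⟩ + X (sF m n ⟨a, by omega⟩) ⟨b, by omega⟩ := by
  simp only [Matrix.add_apply, Matrix.mul_apply, G1_left m n _ b, G1_right m n _ a, mul_ite, ite_mul,
    mul_one, one_mul, mul_zero, zero_mul, Finset.sum_ite_eq', Finset.mem_univ, if_true]
  rfl

theorem eq2_entry (m n : ℕ) (X : Matrix (Fin (2*m+2*n+1)) (Fin (2*m+2*n+1)) ℂ)
    (a b : Fin (2*n)) :
    ((block2 m n X)ᵀ * G2 n + G2 n * block2 m n X) a b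
      = - tg m n (2*m+1+b) * X (sF m n ⟨2*m+1+b, by omega⟩) ⟨2*m+1+a, by omega⟩
        + tg m n (2*m+1+a) * X (sF m n ⟨2*m+1+a, by omega⟩) ⟨2*m+1+b, by omega⟩ := by
  have key : ∀ c : Fin (2*n), 2*m+1 + (sg m n (2*m+1+c) - (2*m+1)) = sg m n (2*m+1+c) := by
    intro c
    unfold sg; split_ifs <;> omega
  simp only [Matrix.add_apply, Matrix.mul_apply, G2_left m n _ b, G2_right m n _ a, mul_ite, ite_mul,
    mul_one, one_mul, mul_zero, zero_mul, Finset.sum_ite_eq', Finset.mem_univ, if_true,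
    Matrix.transpose_apply, block2, Matrix.of_apply, key, sF]
  ring

theorem sg_sg (m n a : ℕ) (h : a < 2*m+2*n+1) : sg m n (sg m n a) = a := by
  unfold sg; split_ifs <;> omega

theorem sF_sF (m n : ℕ) (a : Fin (2*m+2*n+1)) : sF m n (sF m n a) = a :=
  Fin.ext (sg_sg m n a a.isLt)

theorem sg_block (m n a : ℕ) (h : a < 2*m+2*n+1) : sg m n a < 2*m+1 ↔ a < 2*m+1 := by
  unfold sg; split_ifs <;> omega

theorem tg_one (m n a : ℕ) (h : a < 2*m+1) : tg m n a = 1 := by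
  unfold tg; rw [if_pos (by omega)]

theorem tg_sg (m n a : ℕ) (h : a < 2*m+2*n+1) (h' : ¬ a < 2*m+1) :
    tg m n (sg m n a) = - tg m n a := by
  unfold sg tg; split_ifs <;> first | omega | simp

theorem tg_sq (m n a : ℕ) : tg m n a * tg m n a = 1 := by
  unfold tg; split_ifs <;> simp

theorem mem_target_iff (m n : ℕ) (X : Matrix (Fin (2*m+2*n+1)) (Fin (2*m+2*n+1)) ℂ) :
    X ∈ evenTarget m n ↔ evenP m n X := by
  unfold evenTarget evenP
  simp only [Set.mem_ofPred_eq]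
  refine and_congr_right fun h0 => ?_
  constructor
  · rintro ⟨h1, h2⟩ a b
    have ha := sg_block m n a a.isLt
    have hb := sg_block m n b b.isLt
    by_cases ca : a.val < 2*m+1 <;> by_cases cb : b.val < 2*m+1
    · have h := eq1_entry m n X ⟨sF m n a, ha.2 ca⟩ ⟨b, cb⟩
      rw [h1] at h
      simp only [Matrix.zero_apply, Fin.eta, sF_sF] at h
      rw [tg_one m n a ca, tg_one m n b cb]
      linear_combination -h
    · rw [h0 a b (by omega), h0 (sF m n b) (sF m n a) (by simp only [sF]; omega), mul_zero]
    · rw [h0 a b (by omega), h0 (sF m n b) (sF m n a) (by simp only [sF]; omega), mul_zero]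
    · have h := eq2_entry m n X ⟨sF m n a - (2*m+1), by have := (sF m n a).isLt; omega⟩
        ⟨b - (2*m+1), by omega⟩
      rw [h2] at h
      have e1 : 2*m+1 + ((sF m n a).val - (2*m+1)) = (sF m n a).val := by
        have : (sF m n a).val = sg m n a := rfl
        omega
      have e2 : 2*m+1 + (b.val - (2*m+1)) = b.val := by omega
      simp only [Matrix.zero_apply, e1, e2, Fin.eta, sF_sF] at h
      have e3 : tg m n (sF m n a).val = - tg m n a := tg_sg m n a a.isLt ca
      rw [e3] at h
      linear_combination (tg m n a) * h - (X a b) * tg_sq m n a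
  · intro h
    constructor
    · ext a b
      rw [eq1_entry, h (sF m n ⟨b, by omega⟩) ⟨a, by omega⟩, sF_sF,
        tg_one m n (sF m n ⟨b, by omega⟩).val (sg1_lt m n b b.isLt), tg_one m n _ a.isLt]
      simp
    · ext a b
      have e3 : tg m n (sF m n ⟨2*m+1+b, by omega⟩).val = - tg m n (2*m+1+b) :=
        tg_sg m n (2*m+1+b) (by omega) (by omega)
      rw [eq2_entry, h (sF m n ⟨2*m+1+b, by omega⟩) ⟨2*m+1+a, by omega⟩, sF_sF, e3]
      simp only [Matrix.zero_apply]
      linear_combination (- tg m n (2*m+1+a) * X (sF m n ⟨2*m+1+a, by omega⟩) ⟨2*m+1+b, by omega⟩)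
        * tg_sq m n (2*m+1+b)

/-- The standard elements (0-based indices). -/
def Fel (m n a b : ℕ) : Matrix (Fin (2*m+2*n+1)) (Fin (2*m+2*n+1)) ℂ :=
  matE m n (a+1) (b+1) - (tg m n a * tg m n b) • matE m n (sg m n b + 1) (sg m n a + 1)

theorem matE_sF (m n i j : ℕ) (hi : i < 2*m+2*n+1) (hj : j < 2*m+2*n+1)
    (a b : Fin (2*m+2*n+1)) :
    matE m n (sg m n i + 1) (sg m n j + 1) a b = matE m n (i+1) (j+1) (sF m n a) (sF m n b) := by
  simp only [matE, Matrix.of_apply, sF, Nat.add_right_cancel_iff]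
  congr 1
  have h1 := sg_sg m n i hi
  have h2 := sg_sg m n j hj
  have h3 := sg_sg m n a a.isLt
  have h4 := sg_sg m n b b.isLt
  apply propext
  constructor
  · rintro ⟨e1, e2⟩
    rw [e1, e2]; exact ⟨h1, h2⟩
  · rintro ⟨e1, e2⟩
    rw [← e1, ← e2]; exact ⟨h3.symm, h4.symm⟩

theorem matE_swap (m n i j : ℕ) (a b : Fin (2*m+2*n+1)) :
    matE m n i j a b = matE m n j i b a := by
  simp only [matE, Matrix.of_apply, and_comm]

theorem Fel_P (m n i j : ℕ) (hi : i < 2*m+2*n+1) (hj : j < 2*m+2*n+1)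
    (h : i < 2*m+1 ↔ j < 2*m+1) : evenP m n (Fel m n i j) := by
  have hbi := sg_block m n i hi
  have hbj := sg_block m n j hj
  constructor
  · intro a b hab
    have e1 : ¬ (a.val = i ∧ b.val = j) := by omega
    have e2 : ¬ (a.val = sg m n j ∧ b.val = sg m n i) := by omega
    simp [Fel, matE, e1, e2]
  · intro a b
    simp only [Fel, Matrix.sub_apply, Matrix.smul_apply, smul_eq_mul]
    rw [matE_sF m n j i hj hi, matE_sF m n j i hj hi, sF_sF, sF_sF]
    have k1 : tg m n i * tg m n j * (tg m n a * tg m n b) * matE m n (i+1) (j+1) a b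
        = matE m n (i+1) (j+1) a b := by
      simp only [matE, Matrix.of_apply, Nat.add_right_cancel_iff]
      split_ifs with hc
      · rw [hc.1, hc.2]
        linear_combination (tg m n j * tg m n j) * tg_sq m n i + tg_sq m n j
      · simp
    have k2 : (tg m n a * tg m n b) * matE m n (j+1) (i+1) (sF m n a) (sF m n b)
        = tg m n i * tg m n j * matE m n (j+1) (i+1) (sF m n a) (sF m n b) := by
      simp only [matE, Matrix.of_apply, Nat.add_right_cancel_iff, sF]
      split_ifs with hc
      · have ea : a.val = sg m n j := by rw [← hc.1, sg_sg m n a a.isLt]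
        have eb : b.val = sg m n i := by rw [← hc.2, sg_sg m n b b.isLt]
        rw [ea, eb]
        by_cases hj1 : j < 2*m+1
        · rw [tg_one m n _ (hbj.2 hj1), tg_one m n _ (hbi.2 (h.2 hj1)), tg_one m n _ hj1,
            tg_one m n _ (h.2 hj1)]
        · rw [tg_sg m n j hj hj1, tg_sg m n i hi (fun q => hj1 (h.1 q))]
          ring
      · simp
    rw [matE_swap m n (i+1) (j+1) (sF m n b), matE_swap m n (j+1) (i+1) b a]
    linear_combination -k1 + k2

theorem evenP_zero (m n : ℕ) : evenP m n 0 := by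
  constructor <;> simp

theorem evenP_add (m n : ℕ) (X Y : Matrix (Fin (2*m+2*n+1)) (Fin (2*m+2*n+1)) ℂ)
    (hX : evenP m n X) (hY : evenP m n Y) : evenP m n (X + Y) := by
  constructor
  · intro a b h
    rw [Matrix.add_apply, hX.1 a b h, hY.1 a b h, add_zero]
  · intro a b
    rw [Matrix.add_apply, Matrix.add_apply]
    linear_combination hX.2 a b + hY.2 a b

theorem evenP_smul (m n : ℕ) (c : ℂ) (X : Matrix (Fin (2*m+2*n+1)) (Fin (2*m+2*n+1)) ℂ)
    (hX : evenP m n X) : evenP m n (c • X) := by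
  constructor
  · intro a b h
    rw [Matrix.smul_apply, hX.1 a b h, smul_zero]
  · intro a b
    rw [Matrix.smul_apply, Matrix.smul_apply, smul_eq_mul, smul_eq_mul]
    linear_combination c * hX.2 a b

theorem Fel_pos (m n a b i j p q : ℕ) (hi : i = a + 1) (hj : j = b + 1)
    (hp : p = sg m n b + 1) (hq : q = sg m n a + 1)
    (ht : (a < 2*m+1+n) ↔ (b < 2*m+1+n)) :
    Fel m n a b = matE m n i j - matE m n p q := by
  subst hi hj hp hq
  have : tg m n a * tg m n b = 1 := by
    unfold tg; split_ifs <;> first | omega | simp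
  rw [Fel, this, one_smul]

theorem Fel_neg (m n a b i j p q : ℕ) (hi : i = a + 1) (hj : j = b + 1)
    (hp : p = sg m n b + 1) (hq : q = sg m n a + 1)
    (ht : (a < 2*m+1+n) ↔ ¬ (b < 2*m+1+n)) :
    Fel m n a b = matE m n i j + matE m n p q := by
  subst hi hj hp hq
  have : tg m n a * tg m n b = -1 := by
    unfold tg; split_ifs <;> first | omega | simp
  rw [Fel, this, neg_smul, one_smul, sub_neg_eq_add]

theorem gens_P (m n : ℕ) (A : Matrix (Fin (2*m+2*n+1)) (Fin (2*m+2*n+1)) ℂ)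
    (hA : A ∈ evenGens m n) : evenP m n A := by
  have pm : ∀ i k, 1 ≤ i → i ≤ m → 1 ≤ k → k ≤ m →
      evenP m n (matE m n i k - matE m n (k+m) (i+m)) := by
    intro i k hi hi' hk hk'
    rw [← Fel_pos m n (i-1) (k-1) i k (k+m) (i+m) (by omega) (by omega)
      (by unfold sg; split_ifs <;> omega) (by unfold sg; split_ifs <;> omega) (by omega)]
    exact Fel_P m n _ _ (by omega) (by omega) (by omega)
  have apm : ∀ i k, 1 ≤ i → i ≤ n → 1 ≤ k → k ≤ n →
      evenP m n (matE m n (2*m+1+i) (2*m+1+k) - matE m n (2*m+1+n+k) (2*m+1+n+i)) := by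
    intro i k hi hi' hk hk'
    rw [← Fel_pos m n (2*m+i) (2*m+k) _ _ _ _ (by omega) (by omega)
      (by unfold sg; split_ifs <;> omega) (by unfold sg; split_ifs <;> omega) (by omega)]
    exact Fel_P m n _ _ (by omega) (by omega) (by omega)
  rcases hA with (⟨i, k, ξ, η, hi, hk, hξ, hη, rfl⟩ | ⟨l, ε, hl, hε, rfl⟩) |
    ⟨i, k, ξ, η, hi, hk, hξ, hη, rfl⟩
  · rw [Finset.mem_Icc] at hi hk
    rcases hξ with rfl | rfl <;> rcases hη with rfl | rfl
    · rw [comm_pp m n i k hi.1 hi.2 hk.1 hk.2,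
        ← Fel_pos m n (k-1) (i+m-1) _ _ _ _ (by omega) (by omega)
        (by unfold sg; split_ifs <;> omega) (by unfold sg; split_ifs <;> omega) (by omega)]
      exact evenP_smul _ _ _ _ (Fel_P m n _ _ (by omega) (by omega) (by omega))
    · rw [comm_pm m n i k hi.1 hi.2 hk.1 hk.2]
      exact evenP_smul _ _ _ _ (pm i k hi.1 hi.2 hk.1 hk.2)
    · rw [← neg_sub, comm_pm m n k i hk.1 hk.2 hi.1 hi.2, ← neg_smul]
      exact evenP_smul _ _ _ _ (pm k i hk.1 hk.2 hi.1 hi.2)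
    · rw [comm_mm m n i k hi.1 hi.2 hk.1 hk.2,
        ← Fel_pos m n (k+m-1) (i-1) _ _ _ _ (by omega) (by omega)
        (by unfold sg; split_ifs <;> omega) (by unfold sg; split_ifs <;> omega) (by omega)]
      exact evenP_smul _ _ _ _ (Fel_P m n _ _ (by omega) (by omega) (by omega))
  · rw [Finset.mem_Icc] at hl
    rcases hε with rfl | rfl
    · simp only [cgen, hl.2, if_true]
      rw [← Fel_pos m n (l-1) (2*m) _ _ _ _ (by omega) (by omega)
        (by unfold sg; split_ifs <;> omega) (by unfold sg; split_ifs <;> omega) (by omega)]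
      exact evenP_smul _ _ _ _ (Fel_P m n _ _ (by omega) (by omega) (by omega))
    · simp only [cgen, hl.2, if_true, show ((-1:ℤ) = 1) = False by simp, if_false]
      rw [← Fel_pos m n (2*m) (l-1) _ _ _ _ (by omega) (by omega)
        (by unfold sg; split_ifs <;> omega) (by unfold sg; split_ifs <;> omega) (by omega)]
      exact evenP_smul _ _ _ _ (Fel_P m n _ _ (by omega) (by omega) (by omega))
  · rw [Finset.mem_Icc] at hi hk
    rcases hξ with rfl | rfl <;> rcases hη with rfl | rfl
    · rw [anti_pp m n i k hi.1 hi.2 hk.1 hk.2,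
        ← Fel_neg m n (2*m+i) (2*m+n+k) _ _ _ _ (by omega) (by omega)
        (by unfold sg; split_ifs <;> omega) (by unfold sg; split_ifs <;> omega) (by omega)]
      exact evenP_smul _ _ _ _ (Fel_P m n _ _ (by omega) (by omega) (by omega))
    · rw [anti_pm m n i k hi.1 hi.2 hk.1 hk.2]
      exact evenP_smul _ _ _ _ (apm i k hi.1 hi.2 hk.1 hk.2)
    · rw [add_comm, anti_pm m n k i hk.1 hk.2 hi.1 hi.2]
      exact evenP_smul _ _ _ _ (apm k i hk.1 hk.2 hi.1 hi.2)
    · rw [anti_mm m n i k hi.1 hi.2 hk.1 hk.2,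
        ← Fel_neg m n (2*m+n+i) (2*m+k) _ _ _ _ (by omega) (by omega)
        (by unfold sg; split_ifs <;> omega) (by unfold sg; split_ifs <;> omega) (by omega)]
      exact evenP_smul _ _ _ _ (Fel_P m n _ _ (by omega) (by omega) (by omega))

theorem comm_mem (m n i k : ℕ) (ξ η : ℤ) (hi : 1 ≤ i) (hi' : i ≤ m) (hk : 1 ≤ k) (hk' : k ≤ m)
    (hξ : ξ = 1 ∨ ξ = -1) (hη : η = 1 ∨ η = -1) :
    cgen m n i ξ * cgen m n k η - cgen m n k η * cgen m n i ξ
      ∈ Submodule.span ℂ (evenGens m n) :=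
  Submodule.subset_span (Or.inl (Or.inl ⟨i, k, ξ, η, Finset.mem_Icc.2 ⟨hi, hi'⟩,
    Finset.mem_Icc.2 ⟨hk, hk'⟩, hξ, hη, rfl⟩))

theorem anti_mem (m n i k : ℕ) (ξ η : ℤ) (hi : 1 ≤ i) (hi' : i ≤ n) (hk : 1 ≤ k) (hk' : k ≤ n)
    (hξ : ξ = 1 ∨ ξ = -1) (hη : η = 1 ∨ η = -1) :
    cgen m n (m+i) ξ * cgen m n (m+k) η + cgen m n (m+k) η * cgen m n (m+i) ξ
      ∈ Submodule.span ℂ (evenGens m n) :=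
  Submodule.subset_span (Or.inr ⟨i, k, ξ, η, Finset.mem_Icc.2 ⟨hi, hi'⟩,
    Finset.mem_Icc.2 ⟨hk, hk'⟩, hξ, hη, rfl⟩)

theorem cgen_mem (m n l : ℕ) (ε : ℤ) (hl : 1 ≤ l) (hl' : l ≤ m) (hε : ε = 1 ∨ ε = -1) :
    cgen m n l ε ∈ Submodule.span ℂ (evenGens m n) :=
  Submodule.subset_span (Or.inl (Or.inr ⟨l, ε, Finset.mem_Icc.2 ⟨hl, hl'⟩, hε, rfl⟩))

theorem mem_of_smul {V : Type*} [AddCommGroup V] [Module ℂ V] (W : Submodule ℂ V) (c : ℂ)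
    (hc : c ≠ 0) (x : V) (h : c • x ∈ W) : x ∈ W :=
  (W.smul_mem_iff hc).1 h

theorem Fel_mem (m n a b : ℕ) (ha : a < 2*m+2*n+1) (hb : b < 2*m+2*n+1)
    (h : a < 2*m+1 ↔ b < 2*m+1) : Fel m n a b ∈ Submodule.span ℂ (evenGens m n) := by
  have h2 : (2:ℂ) ≠ 0 := by norm_num
  have h2' : (-2:ℂ) ≠ 0 := by norm_num
  have hs : (Real.sqrt 2 : ℂ) ≠ 0 := by
    intro h0
    have := sqrt_two_mul
    rw [h0] at this
    norm_num at this
  have cp : ∀ l, 1 ≤ l → l ≤ m → matE m n l (2*m+1) - matE m n (2*m+1) (l+m) ∈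
      Submodule.span ℂ (evenGens m n) := by
    intro l hl hl'
    have := cgen_mem m n l 1 hl hl' (by simp)
    simp only [cgen, hl', if_true] at this
    exact mem_of_smul _ _ hs _ this
  have cm : ∀ l, 1 ≤ l → l ≤ m → matE m n (2*m+1) l - matE m n (l+m) (2*m+1) ∈
      Submodule.span ℂ (evenGens m n) := by
    intro l hl hl'
    have := cgen_mem m n l (-1) hl hl' (by simp)
    simp only [cgen, hl', if_true, show ((-1:ℤ) = 1) = False by simp, if_false] at this
    exact mem_of_smul _ _ hs _ this
  have pm : ∀ i k, 1 ≤ i → i ≤ m → 1 ≤ k → k ≤ m →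
      matE m n i k - matE m n (k+m) (i+m) ∈ Submodule.span ℂ (evenGens m n) := by
    intro i k hi hi' hk hk'
    have := comm_mem m n i k 1 (-1) hi hi' hk hk' (by simp) (by simp)
    rw [comm_pm m n i k hi hi' hk hk'] at this
    exact mem_of_smul _ _ h2 _ this
  have apm : ∀ i k, 1 ≤ i → i ≤ n → 1 ≤ k → k ≤ n →
      matE m n (2*m+1+i) (2*m+1+k) - matE m n (2*m+1+n+k) (2*m+1+n+i) ∈
        Submodule.span ℂ (evenGens m n) := by
    intro i k hi hi' hk hk'
    have := anti_mem m n i k 1 (-1) hi hi' hk hk' (by simp) (by simp)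
    rw [anti_pm m n i k hi hi' hk hk'] at this
    exact mem_of_smul _ _ h2 _ this
  by_cases a1 : a < 2*m+1
  · have b1 := h.1 a1
    rcases (by omega : a < m ∨ (m ≤ a ∧ a < 2*m) ∨ a = 2*m) with ca | ca | ca <;>
    rcases (by omega : b < m ∨ (m ≤ b ∧ b < 2*m) ∨ b = 2*m) with cb | cb | cb
    · rw [Fel_pos m n a b (a+1) (b+1) (b+1+m) (a+1+m) (by omega) (by omega)
        (by unfold sg; split_ifs <;> omega) (by unfold sg; split_ifs <;> omega) (by omega)]
      exact pm _ _ (by omega) (by omega) (by omega) (by omega)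
    · rw [Fel_pos m n a b (a+1) (b-m+1+m) (b-m+1) (a+1+m) (by omega) (by omega)
        (by unfold sg; split_ifs <;> omega) (by unfold sg; split_ifs <;> omega) (by omega)]
      refine mem_of_smul _ _ h2 _ ?_
      rw [← comm_pp m n (b-m+1) (a+1) (by omega) (by omega) (by omega) (by omega)]
      exact comm_mem _ _ _ _ _ _ (by omega) (by omega) (by omega) (by omega) (by simp) (by simp)
    · rw [Fel_pos m n a b (a+1) (2*m+1) (2*m+1) (a+1+m) (by omega) (by omega)
        (by unfold sg; split_ifs <;> omega) (by unfold sg; split_ifs <;> omega) (by omega)]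
      exact cp _ (by omega) (by omega)
    · rw [Fel_pos m n a b (a-m+1+m) (b+1) (b+1+m) (a-m+1) (by omega) (by omega)
        (by unfold sg; split_ifs <;> omega) (by unfold sg; split_ifs <;> omega) (by omega)]
      refine mem_of_smul _ _ h2 _ ?_
      rw [← comm_mm m n (b+1) (a-m+1) (by omega) (by omega) (by omega) (by omega)]
      exact comm_mem _ _ _ _ _ _ (by omega) (by omega) (by omega) (by omega) (by simp) (by simp)
    · rw [Fel_pos m n a b (a-m+1+m) (b-m+1+m) (b-m+1) (a-m+1) (by omega) (by omega)
        (by unfold sg; split_ifs <;> omega) (by unfold sg; split_ifs <;> omega) (by omega),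
        ← neg_sub]
      exact neg_mem (pm _ _ (by omega) (by omega) (by omega) (by omega))
    · rw [Fel_pos m n a b (a-m+1+m) (2*m+1) (2*m+1) (a-m+1) (by omega) (by omega)
        (by unfold sg; split_ifs <;> omega) (by unfold sg; split_ifs <;> omega) (by omega),
        ← neg_sub]
      exact neg_mem (cm _ (by omega) (by omega))
    · rw [Fel_pos m n a b (2*m+1) (b+1) (b+1+m) (2*m+1) (by omega) (by omega)
        (by unfold sg; split_ifs <;> omega) (by unfold sg; split_ifs <;> omega) (by omega)]
      exact cm _ (by omega) (by omega)
    · rw [Fel_pos m n a b (2*m+1) (b-m+1+m) (b-m+1) (2*m+1) (by omega) (by omega)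
        (by unfold sg; split_ifs <;> omega) (by unfold sg; split_ifs <;> omega) (by omega),
        ← neg_sub]
      exact neg_mem (cp _ (by omega) (by omega))
    · rw [Fel_pos m n a b (2*m+1) (2*m+1) (2*m+1) (2*m+1) (by omega) (by omega)
        (by unfold sg; split_ifs <;> omega) (by unfold sg; split_ifs <;> omega) (by omega),
        sub_self]
      exact zero_mem _
  · have b1 : ¬ b < 2*m+1 := fun q => a1 (h.2 q)
    by_cases ca : a < 2*m+1+n <;> by_cases cb : b < 2*m+1+n
    · rw [Fel_pos m n a b (2*m+1+(a-2*m)) (2*m+1+(b-2*m)) (2*m+1+n+(b-2*m)) (2*m+1+n+(a-2*m))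
        (by omega) (by omega)
        (by unfold sg; split_ifs <;> omega) (by unfold sg; split_ifs <;> omega) (by omega)]
      exact apm _ _ (by omega) (by omega) (by omega) (by omega)
    · rw [Fel_neg m n a b (2*m+1+(a-2*m)) (2*m+1+n+(b-n-2*m)) (2*m+1+(b-n-2*m)) (2*m+1+n+(a-2*m))
        (by omega) (by omega)
        (by unfold sg; split_ifs <;> omega) (by unfold sg; split_ifs <;> omega) (by omega)]
      refine mem_of_smul _ _ h2 _ ?_
      rw [← anti_pp m n (a-2*m) (b-n-2*m) (by omega) (by omega) (by omega) (by omega)]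
      exact anti_mem _ _ _ _ _ _ (by omega) (by omega) (by omega) (by omega) (by simp) (by simp)
    · rw [Fel_neg m n a b (2*m+1+n+(a-n-2*m)) (2*m+1+(b-2*m)) (2*m+1+n+(b-2*m)) (2*m+1+(a-n-2*m))
        (by omega) (by omega)
        (by unfold sg; split_ifs <;> omega) (by unfold sg; split_ifs <;> omega) (by omega)]
      refine mem_of_smul _ _ h2' _ ?_
      rw [← anti_mm m n (a-n-2*m) (b-2*m) (by omega) (by omega) (by omega) (by omega)]
      exact anti_mem _ _ _ _ _ _ (by omega) (by omega) (by omega) (by omega) (by simp) (by simp)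
    · rw [Fel_pos m n a b (2*m+1+n+(a-n-2*m)) (2*m+1+n+(b-n-2*m)) (2*m+1+(b-n-2*m))
        (2*m+1+(a-n-2*m)) (by omega) (by omega)
        (by unfold sg; split_ifs <;> omega) (by unfold sg; split_ifs <;> omega) (by omega),
        ← neg_sub]
      exact neg_mem (apm _ _ (by omega) (by omega) (by omega) (by omega))

theorem sum_matE (m n : ℕ) (f : Fin (2*m+2*n+1) → Fin (2*m+2*n+1) → ℂ)
    (p q : Fin (2*m+2*n+1)) :
    ∑ a, ∑ b, f a b * matE m n (a.val+1) (b.val+1) p q = f p q := by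
  rw [Finset.sum_eq_single p, Finset.sum_eq_single q]
  · simp [matE]
  · intro b _ hb
    have : ¬ (q.val = b.val) := fun e => hb (Fin.ext e.symm)
    simp [matE, this]
  · simp
  · intro a _ ha
    have : ¬ (p.val = a.val) := fun e => ha (Fin.ext e.symm)
    simp [matE, this]
  · simp

theorem expand (m n : ℕ) (X : Matrix (Fin (2*m+2*n+1)) (Fin (2*m+2*n+1)) ℂ)
    (hX : evenP m n X) : (2:ℂ) • X = ∑ a, ∑ b, X a b • Fel m n a.val b.val := by
  ext p q
  simp only [Matrix.sum_apply, Matrix.smul_apply, smul_eq_mul, Fel, Matrix.sub_apply, mul_sub,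
    Finset.sum_sub_distrib]
  rw [sum_matE m n (fun a b => X a b) p q]
  have e : ∀ a b : Fin (2*m+2*n+1), X a b * (tg m n a * tg m n b *
      matE m n (sg m n b + 1) (sg m n a + 1) p q)
      = (X a b * (tg m n a * tg m n b)) * matE m n (a.val+1) (b.val+1) (sF m n q) (sF m n p) := by
    intro a b
    rw [matE_sF m n b a b.isLt a.isLt, matE_swap m n (b.val+1)]
    ring
  simp only [e]
  rw [sum_matE m n (fun a b => X a b * (tg m n a * tg m n b))]
  have h := hX.2 (sF m n q) (sF m n p)
  rw [sF_sF, sF_sF] at h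
  set t := tg m n (sF m n q).val with ht
  set u := tg m n (sF m n p).val with hu
  have h1 : t * t = 1 := tg_sq _ _ _
  have h3 : u * u = 1 := tg_sq _ _ _
  linear_combination (t * u) * h - (X p q) * (u * u) * h1 - (X p q) * h3

/-- the span of the listed brackets and generators is precisely the
even subalgebra so(2m+1) ⊕ sp(2n) of osp(2m+1|2n). -/
theorem even_subalgebra (m n : ℕ) (hm : 0 < m) (hn : 0 < n) :
    (Submodule.span ℂ (evenGens m n) : Set (Matrix (Fin (2*m+2*n+1)) (Fin (2*m+2*n+1)) ℂ))
      = evenTarget m n := by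
  ext X
  rw [mem_target_iff, SetLike.mem_coe]
  constructor
  · intro h
    induction h using Submodule.span_induction with
    | mem x hx => exact gens_P m n x hx
    | zero => exact evenP_zero m n
    | add x y _ _ hx hy => exact evenP_add m n x y hx hy
    | smul c x _ hx => exact evenP_smul m n c x hx
  · intro h
    refine mem_of_smul _ (2:ℂ) (by norm_num) _ ?_
    rw [expand m n X h]
    refine Submodule.sum_mem _ fun a _ => Submodule.sum_mem _ fun b _ => ?_
    by_cases hab : a.val < 2*m+1 ↔ b.val < 2*m+1
    · exact Submodule.smul_mem _ _ (Fel_mem m n a b a.isLt b.isLt hab)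
    · rw [h.1 a b (by omega), zero_smul]
      exact zero_mem _

end
end

section
/- In the formal power series ring ℚ[[x_1,…,x_m,y_1,…,y_n]] the following identity (due to Cummins and King) holds: ∏_{i=1}^m ∏_{j=1}^n (1+x_i y_j) = ∏_{i=1}^m (1−x_i) · ∏_{1≤i<k≤m} (1−x_i x_k) · ∏_{j=1}^n (1−y_j) · ∏_{1≤j<l≤n} (1−y_j y_l) · Σ_{λ∈H} s_λ(x|y), where the sum runs over all partitions λ in the (m|n)-hook H. -/
noncomputable section

/-- A skew semistandard Young tableau of shape `lam/tau` with entries in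
`{0,…,m-1}` (representing the variables `x_1,…,x_m`): entries are `< m` on the
cells of `lam \ tau`, rows are weakly increasing, columns are strictly
increasing, and the tableau vanishes outside the skew shape. -/
def IsSkewSSYT (m : ℕ) (lam tau : YoungDiagram) (T : ℕ → ℕ → ℕ) : Prop :=
  (∀ i j : ℕ, (i, j) ∈ lam.cells \ tau.cells → T i j < m) ∧
  (∀ i j1 j2 : ℕ, j1 ≤ j2 → (i, j1) ∈ lam.cells \ tau.cells →
      (i, j2) ∈ lam.cells \ tau.cells → T i j1 ≤ T i j2) ∧
  (∀ i1 i2 j : ℕ, i1 < i2 → (i1, j) ∈ lam.cells \ tau.cells →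
      (i2, j) ∈ lam.cells \ tau.cells → T i1 j < T i2 j) ∧
  (∀ i j : ℕ, (i, j) ∉ lam.cells \ tau.cells → T i j = 0)

/-- The coefficient of the monomial `d` in the supersymmetric Schur function
`s_lam(x|y) = Σ_{τ ⊆ lam} s_{lam/τ}(x) s_{τ'}(y)`: the number of triples
`(τ, T_x, T_y)` where `τ ⊆ lam`, `T_x` is a skew SSYT of shape `lam/τ` in the
`x`-alphabet with content `d ∘ inl`, and `T_y` is an SSYT of shape `τ'` in the
`y`-alphabet with content `d ∘ inr`. -/
def superSchurCoeff (m n : ℕ) (lam : YoungDiagram) (d : (Fin m ⊕ Fin n) →₀ ℕ) : ℕ :=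
  Set.ncard {t : YoungDiagram × (ℕ → ℕ → ℕ) × (ℕ → ℕ → ℕ) |
    t.1 ≤ lam ∧ IsSkewSSYT m lam t.1 t.2.1 ∧
    IsSkewSSYT n t.1.transpose ⊥ t.2.2 ∧
    (∀ k : Fin m, d (Sum.inl k)
        = ((lam.cells \ t.1.cells).filter fun c => t.2.1 c.1 c.2 = k.val).card) ∧
    (∀ k : Fin n, d (Sum.inr k)
        = ((t.1.transpose.cells \ (⊥ : YoungDiagram).cells).filter
            fun c => t.2.2 c.1 c.2 = k.val).card)}

/-- The supersymmetric Schur function `s_lam(x|y)` as a formal power series in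
`x_1,…,x_m, y_1,…,y_n`. -/
def superSchur (m n : ℕ) (lam : YoungDiagram) : MvPowerSeries (Fin m ⊕ Fin n) ℚ :=
  fun d => (superSchurCoeff m n lam d : ℚ)

/-- The coefficientwise sum `Σ_{lam ∈ S} c(lam) · s_lam(x|y)` of supersymmetric
Schur functions over a set `S` of partitions with coefficients `c`; it is well
defined coefficientwise since only finitely many partitions contribute to a
given coefficient. -/
def superSchurSum (m n : ℕ) (S : Set YoungDiagram) (c : YoungDiagram → ℚ) :
    MvPowerSeries (Fin m ⊕ Fin n) ℚ :=
  fun d => ∑' lam : S, c lam * (superSchurCoeff m n (lam : YoungDiagram) d : ℚ)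


section GenAlg

variable {σ : Type*} [DecidableEq σ] {A : Type*} [Ring A]

/-- The power series `∑ g k * X s ^ k` in the single variable `X s`. -/
def gen (s : σ) (g : ℕ → A) : MvPowerSeries σ A :=
  fun d => if d = Finsupp.single s (d s) then g (d s) else 0

theorem coeff_gen (s : σ) (g : ℕ → A) (d : σ →₀ ℕ) :
    MvPowerSeries.coeff d (gen s g) = if d = Finsupp.single s (d s) then g (d s) else 0 := rfl

theorem coeff_gen_single (s : σ) (g : ℕ → A) (k : ℕ) :
    MvPowerSeries.coeff (Finsupp.single s k) (gen s g) = g k := by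
  rw [coeff_gen]; simp

theorem coeff_gen_mul (s : σ) (g : ℕ → A) (F : MvPowerSeries σ A) (d : σ →₀ ℕ) :
    MvPowerSeries.coeff d (gen s g * F) = ∑ p ∈ Finset.HasAntidiagonal.antidiagonal (d s),
      g p.1 * MvPowerSeries.coeff (d.update s p.2) F := by
  rw [MvPowerSeries.coeff_mul]
  symm
  apply Finset.sum_of_injOn (fun p : ℕ × ℕ => (Finsupp.single s p.1, d.update s p.2))
  · intro p hp q hq h
    simp only [Prod.mk.injEq] at h
    have h1 := DFunLike.congr_fun h.1 s
    have h2 := DFunLike.congr_fun h.2 s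
    simp at h1 h2
    exact Prod.ext h1 h2
  · intro p hp
    simp only [Finset.mem_coe, Finset.HasAntidiagonal.mem_antidiagonal] at hp ⊢
    ext t
    by_cases ht : t = s
    · subst ht; simp [hp]
    · simp [Finsupp.update_apply, Finsupp.single_apply, ht, Ne.symm ht]
  · rintro ⟨a, b⟩ hi hn
    simp only [Finset.HasAntidiagonal.mem_antidiagonal] at hi
    rw [coeff_gen]
    split_ifs with h
    · exfalso
      apply hn
      refine ⟨(a s, b s), ?_, ?_⟩
      · simp [← hi]
      · simp only [Prod.mk.injEq]
        refine ⟨h.symm, ?_⟩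
        ext t
        by_cases ht : t = s
        · subst ht; simp
        · have := DFunLike.congr_fun h t
          simp [Finsupp.single_apply, Ne.symm ht] at this
          simp [Finsupp.update_apply, ht, ← hi, this]
    · simp
  · intro p hp
    simp [coeff_gen_single]

theorem coeff_gen_mul_gen (s t : σ) (hst : s ≠ t) (g h : ℕ → A) (d : σ →₀ ℕ) :
    MvPowerSeries.coeff d (gen s g * gen t h) =
      if d = Finsupp.single s (d s) + Finsupp.single t (d t) then g (d s) * h (d t) else 0 := by
  rw [coeff_gen_mul, Finset.sum_eq_single (d s, 0)]
  · rw [coeff_gen]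
    have h1 : (d.update s 0) t = d t := by simp [Finsupp.update_apply, hst.symm]
    simp only [h1]
    have : d.update s 0 = Finsupp.single t (d t) ↔
        d = Finsupp.single s (d s) + Finsupp.single t (d t) := by
      constructor
      · intro h2
        ext u
        have := DFunLike.congr_fun h2 u
        by_cases hu : u = s
        · subst hu; simp [Finsupp.single_apply, hst.symm]
        · simp [Finsupp.update_apply, hu] at this
          simp [Finsupp.single_apply, this, Ne.symm hu]
      · intro h2
        ext u
        have := DFunLike.congr_fun h2 u
        by_cases hu : u = s
        · subst hu; simp [Finsupp.single_apply, hst.symm]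
        · simp [Finsupp.single_apply, Ne.symm hu] at this
          simp [Finsupp.update_apply, hu, Finsupp.single_apply, this]
    simp only [this]
    split_ifs <;> simp
  · rintro ⟨a, b⟩ hp hne
    rw [Finset.HasAntidiagonal.mem_antidiagonal] at hp
    rw [coeff_gen, if_neg, mul_zero]
    intro h2
    have := DFunLike.congr_fun h2 s
    simp [Finsupp.single_apply, hst.symm] at this
    simp only at hp
    apply hne
    ext <;> simp <;> omega
  · intro h; simp at h

theorem gen_mul_gen_same (s : σ) (g h : ℕ → A) :
    gen s g * gen s h = gen s (fun k => ∑ p ∈ Finset.HasAntidiagonal.antidiagonal k, g p.1 * h p.2) := by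
  ext d
  rw [coeff_gen_mul, coeff_gen]
  have key : ∀ b, (d.update s b = Finsupp.single s b) ↔ d = Finsupp.single s (d s) := by
    intro b
    constructor
    · intro h2
      ext u
      have := DFunLike.congr_fun h2 u
      by_cases hu : u = s
      · subst hu; simp
      · simpa [Finsupp.update_apply, hu, Finsupp.single_apply, Ne.symm hu] using this
    · intro h2
      ext u
      have := DFunLike.congr_fun h2 u
      by_cases hu : u = s
      · subst hu; simp
      · simpa [Finsupp.update_apply, hu, Finsupp.single_apply, Ne.symm hu] using this
  split_ifs with h2
  · apply Finset.sum_congr rfl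
    intro p hp
    rw [coeff_gen]
    simp [key, ← h2]
  · apply Finset.sum_eq_zero
    intro p hp
    rw [coeff_gen]
    simp [key, h2]

theorem gen_one (s : σ) : gen s (fun k => if k = 0 then (1 : A) else 0) = 1 := by
  ext d
  rw [coeff_gen, MvPowerSeries.coeff_one]
  by_cases h : d = 0
  · subst h; simp
  · rw [if_neg h]
    split_ifs with h1 h2
    · rw [h2] at h1; simp at h1; exact absurd h1 h
    · rfl
    · rfl

theorem gen_sub (s : σ) (g h : ℕ → A) : gen s g - gen s h = gen s (fun k => g k - h k) := by
  ext d
  rw [map_sub, coeff_gen, coeff_gen, coeff_gen]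
  split_ifs <;> simp

/-- Shift of a sequence. -/
def sh (g : ℕ → A) : ℕ → A
  | 0 => 0
  | k + 1 => g k

theorem gen_X (s : σ) : gen s (fun k => if k = 1 then (1 : A) else 0) = MvPowerSeries.X s := by
  ext d
  rw [coeff_gen, MvPowerSeries.coeff_X]
  by_cases h : d = Finsupp.single s 1
  · subst h; simp
  · rw [if_neg h]
    split_ifs with h1 h2
    · rw [h2] at h1; exact absurd h1 h
    · rfl
    · rfl

theorem X_mul_gen (s : σ) (g : ℕ → A) : MvPowerSeries.X s * gen s g = gen s (sh g) := by
  rw [← gen_X, gen_mul_gen_same]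
  congr 1
  funext k
  cases k with
  | zero => simp [sh]
  | succ k =>
    rw [Finset.sum_eq_single (1, k)]
    · simp [sh]
    · rintro ⟨a, b⟩ hp hne
      rw [Finset.HasAntidiagonal.mem_antidiagonal] at hp
      rw [if_neg, zero_mul]
      rintro h
      simp only at hp h
      apply hne
      ext <;> simp <;> omega
    · intro h; simp [add_comm] at h

theorem gen_mul_X (s : σ) (g : ℕ → A) : gen s g * MvPowerSeries.X s = gen s (sh g) := by
  rw [← X_mul_gen, MvPowerSeries.X_mul]

/-- The generic commutation relation. -/
theorem gen_comm (s t : σ) (hst : s ≠ t) (D U : ℕ → A)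
    (h0 : ∀ k, D 0 * U k = U k * D 0) (h0' : ∀ k, D k * U 0 = U 0 * D k)
    (h1 : ∀ j k, D (j + 1) * U (k + 1) = U (k + 1) * D (j + 1) + D j * U k) :
    gen s D * gen t U * (1 - MvPowerSeries.X s * MvPowerSeries.X t) = gen t U * gen s D := by
  have e : gen s D * gen t U * (MvPowerSeries.X s * MvPowerSeries.X t)
      = gen s (sh D) * gen t (sh U) := by
    rw [← gen_mul_X, ← gen_mul_X, mul_assoc, mul_assoc, ← mul_assoc (gen t U), ← MvPowerSeries.X_mul (s := s),
      mul_assoc]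
  rw [mul_sub, mul_one, e]
  ext d
  rw [map_sub, coeff_gen_mul_gen s t hst, coeff_gen_mul_gen s t hst, coeff_gen_mul_gen t s hst.symm,
    add_comm (Finsupp.single t (d t))]
  split_ifs with h
  · rcases hj : d s with _ | j <;> rcases hk : d t with _ | k
    · simp [sh, h0]
    · simp [sh, h0]
    · simp [sh, h0']
    · simp [sh, h1]
  · simp

variable [Algebra ℚ A]

/-- Scalars: power series over `ℚ` viewed in power series over `A`. -/
def cc : MvPowerSeries σ ℚ →+* MvPowerSeries σ A := MvPowerSeries.map (algebraMap ℚ A)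

theorem cc_X (s : σ) : cc (A := A) (MvPowerSeries.X s) = MvPowerSeries.X s := by
  simp [cc, MvPowerSeries.map_X]

theorem cc_comm (p : MvPowerSeries σ ℚ) (F : MvPowerSeries σ A) : cc p * F = F * cc p := by
  ext d
  rw [MvPowerSeries.coeff_mul, MvPowerSeries.coeff_mul,
    ← Finsupp.sum_antidiagonal_swap d fun a b =>
      MvPowerSeries.coeff b F * MvPowerSeries.coeff a (cc p)]
  apply Finset.sum_congr rfl
  intro q hq
  simp [cc, Algebra.commutes]

/-- Apply a linear functional coefficientwise. -/
def phi (l : A →ₗ[ℚ] ℚ) (F : MvPowerSeries σ A) : MvPowerSeries σ ℚ :=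
  fun d => l (MvPowerSeries.coeff d F)

theorem coeff_phi (l : A →ₗ[ℚ] ℚ) (F : MvPowerSeries σ A) (d : σ →₀ ℕ) :
    MvPowerSeries.coeff d (phi l F) = l (MvPowerSeries.coeff d F) := rfl

theorem phi_mul_cc (l : A →ₗ[ℚ] ℚ) (F : MvPowerSeries σ A) (p : MvPowerSeries σ ℚ) :
    phi l (F * cc p) = phi l F * p := by
  ext d
  rw [coeff_phi, MvPowerSeries.coeff_mul, MvPowerSeries.coeff_mul, map_sum]
  apply Finset.sum_congr rfl
  intro q hq
  rw [coeff_phi, cc, MvPowerSeries.coeff_map, ← Algebra.commutes, ← Algebra.smul_def, map_smul, smul_eq_mul, mul_comm]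

theorem phi_congr_left (l : A →ₗ[ℚ] ℚ) (G G' F : MvPowerSeries σ A)
    (h : ∀ d a, l (MvPowerSeries.coeff d G * a) = l (MvPowerSeries.coeff d G' * a)) :
    phi l (G * F) = phi l (G' * F) := by
  ext d
  rw [coeff_phi, coeff_phi, MvPowerSeries.coeff_mul, MvPowerSeries.coeff_mul, map_sum, map_sum]
  exact Finset.sum_congr rfl fun q _ => h _ _

theorem phi_congr_right (l : A →ₗ[ℚ] ℚ) (G G' F : MvPowerSeries σ A)
    (h : ∀ d a, l (a * MvPowerSeries.coeff d G) = l (a * MvPowerSeries.coeff d G')) :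
    phi l (F * G) = phi l (F * G') := by
  ext d
  rw [coeff_phi, coeff_phi, MvPowerSeries.coeff_mul, MvPowerSeries.coeff_mul, map_sum, map_sum]
  exact Finset.sum_congr rfl fun q _ => h _ _

end GenAlg


section Abstract

/-- The ordered product of the generating series over the first `k` variables. -/
def PP {σ : Type*} [DecidableEq σ] {A : Type*} [Ring A] (U : ℕ → A) (xs : ℕ → σ) :
    ℕ → MvPowerSeries σ A
  | 0 => 1
  | k + 1 => gen (xs k) U * PP U xs k

variable {σ : Type*} [DecidableEq σ] {A : Type*} [Ring A] [Algebra ℚ A]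

/-- The operator identities needed for the main computation. -/
structure OpData (U V D : ℕ → A) (T : A) (l : A →ₗ[ℚ] ℚ) : Prop where
  D0 : D 0 = 1
  U0 : U 0 = 1
  DU : ∀ j k, D (j + 1) * U (k + 1) = U (k + 1) * D (j + 1) + D j * U k
  UV : ∀ n, ∑ p ∈ Finset.HasAntidiagonal.antidiagonal n, ((-1 : A) ^ p.1 * U p.1) * V p.2
    = if n = 0 then 1 else 0
  VU : ∀ n, ∑ p ∈ Finset.HasAntidiagonal.antidiagonal n, V p.1 * ((-1 : A) ^ p.2 * U p.2)
    = if n = 0 then 1 else 0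
  lU : ∀ k a, l (U (k + 1) * a) = l (D (k + 1) * a) + l (U k * a)
  lD : ∀ k a, l (a * D (k + 1)) = 0
  TV : ∀ k, T * V k = U k * T
  lT : ∀ a, l (T * a) = l a
  lT' : ∀ a, l (a * T) = l a

variable {U V D : ℕ → A} {T : A} {l : A →ₗ[ℚ] ℚ}

theorem rel_DU (H : OpData U V D T l) (s t : σ) (hst : s ≠ t) :
    gen s D * gen t U * cc (1 - MvPowerSeries.X s * MvPowerSeries.X t) = gen t U * gen s D := by
  rw [map_sub, map_mul, cc_X, cc_X, map_one]
  apply gen_comm s t hst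
  · simp [H.D0]
  · simp [H.U0]
  · exact H.DU

theorem rel_DV (H : OpData U V D T l) (s t : σ) (hst : s ≠ t) :
    gen s D * gen t V = gen t V * gen s D * cc (1 + MvPowerSeries.X s * MvPowerSeries.X t) := by
  set W : ℕ → A := fun k => (-1 : A) ^ k * U k with hW
  have hcomm : ∀ k (a : A), (-1 : A) ^ k * a = a * (-1 : A) ^ k := fun k a =>
    ((Commute.neg_one_left a).pow_left k).eq
  have h2 : gen s D * gen t W * (1 + MvPowerSeries.X s * MvPowerSeries.X t)
      = gen t W * gen s D := by
    have e : gen s D * gen t W * (MvPowerSeries.X s * MvPowerSeries.X t)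
        = gen s (sh D) * gen t (sh W) := by
      rw [← gen_mul_X, ← gen_mul_X, mul_assoc, mul_assoc, ← mul_assoc (gen t W),
        ← MvPowerSeries.X_mul (s := s), mul_assoc]
    rw [mul_add, mul_one, e]
    ext d
    rw [map_add, coeff_gen_mul_gen s t hst, coeff_gen_mul_gen s t hst,
      coeff_gen_mul_gen t s hst.symm, add_comm (Finsupp.single t (d t))]
    split_ifs with h
    · rcases hj : d s with _ | j <;> rcases hk : d t with _ | k
      · simp [sh, H.D0]
      · simp [sh, H.D0]
      · simp [sh, hW, H.U0]
      · simp only [sh, hW]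
        rw [← mul_assoc (D (j+1)), ← hcomm, mul_assoc, ← mul_assoc (D j), ← hcomm, mul_assoc, H.DU,
          pow_succ]
        noncomm_ring
    · simp
  have hWV : gen t W * gen t V = 1 := by
    rw [gen_mul_gen_same, ← gen_one t]
    congr 1
    funext k
    exact H.UV k
  have hVW : gen t V * gen t W = 1 := by
    rw [gen_mul_gen_same, ← gen_one t]
    congr 1
    funext k
    exact H.VU k
  have h3 : (1 + MvPowerSeries.X s * MvPowerSeries.X t : MvPowerSeries σ A)
      = cc (1 + MvPowerSeries.X s * MvPowerSeries.X t) := by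
    rw [map_add, map_mul, cc_X, cc_X, map_one]
  rw [h3] at h2
  calc gen s D * gen t V = gen t V * (gen t W * gen s D) * gen t V := by
        rw [← mul_assoc, hVW, one_mul]
    _ = gen t V * gen s D * (gen t W * gen t V) *
          cc (1 + MvPowerSeries.X s * MvPowerSeries.X t) := by
        rw [← h2, mul_assoc, mul_assoc, mul_assoc, cc_comm]
        noncomm_ring
    _ = _ := by rw [hWV, mul_one]

theorem rel_D_PPU (H : OpData U V D T l) (s : σ) (xs : ℕ → σ) (k : ℕ)
    (h : ∀ i < k, s ≠ xs i) :
    gen s D * PP U xs k * cc (∏ i ∈ Finset.range k,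
      (1 - MvPowerSeries.X s * MvPowerSeries.X (xs i))) = PP U xs k * gen s D := by
  induction k with
  | zero => simp [PP]
  | succ k ih =>
    rw [Finset.prod_range_succ, map_mul, PP]
    have h1 := rel_DU H s (xs k) (h k (by omega))
    have h2 := ih (fun i hi => h i (by omega))
    rw [mul_assoc (gen (xs k) U), ← h2]
    set p := ∏ i ∈ Finset.range k, (1 - MvPowerSeries.X s * MvPowerSeries.X (xs i) :
      MvPowerSeries σ ℚ)
    set q := (1 - MvPowerSeries.X s * MvPowerSeries.X (xs k) : MvPowerSeries σ ℚ)
    calc gen s D * (gen (xs k) U * PP U xs k) * (cc p * cc q)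
        = gen s D * gen (xs k) U * (PP U xs k * cc p * cc q) := by simp only [mul_assoc]
      _ = gen s D * gen (xs k) U * cc q * (PP U xs k * cc p) := by
        rw [← cc_comm q]; simp only [mul_assoc]
      _ = _ := by rw [h1]; simp only [mul_assoc]

theorem rel_D_PPV (H : OpData U V D T l) (s : σ) (ys : ℕ → σ) (k : ℕ)
    (h : ∀ i < k, s ≠ ys i) :
    gen s D * PP V ys k = PP V ys k * gen s D * cc (∏ i ∈ Finset.range k,
      (1 + MvPowerSeries.X s * MvPowerSeries.X (ys i))) := by
  induction k with
  | zero => simp [PP]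
  | succ k ih =>
    rw [Finset.prod_range_succ, map_mul, PP]
    have h1 := rel_DV H s (ys k) (h k (by omega))
    have h2 := ih (fun i hi => h i (by omega))
    rw [← mul_assoc, h1, mul_assoc _ _ (PP V ys k), cc_comm, mul_assoc (gen (ys k) V),
      ← mul_assoc (gen s D), h2]
    simp only [mul_assoc]

theorem phi_U (H : OpData U V D T l) (s : σ) (F : MvPowerSeries σ A) :
    phi l (gen s U * F) * (1 - MvPowerSeries.X s) = phi l (gen s D * F) := by
  rw [← phi_mul_cc, mul_assoc, ← cc_comm, ← mul_assoc, map_sub, map_one, cc_X, mul_sub, mul_one,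
    gen_mul_X, gen_sub]
  apply phi_congr_left
  intro d a
  rw [coeff_gen, coeff_gen]
  split_ifs with h
  · rcases d s with _ | k
    · simp [sh, H.D0, H.U0]
    · rw [sub_mul, map_sub, H.lU]; simp [sh]
  · rfl

theorem phi_D (H : OpData U V D T l) (s : σ) (F : MvPowerSeries σ A) :
    phi l (F * gen s D) = phi l F := by
  conv_rhs => rw [← mul_one F]
  apply phi_congr_right
  intro d a
  rw [← gen_one s, coeff_gen, coeff_gen]
  split_ifs with h h'
  · simp [h', H.D0]
  · rcases hd : d s with _ | k
    · omega
    · simp [H.lD]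
  · rfl

theorem phi_PPV (H : OpData U V D T l) (ys : ℕ → σ) (k : ℕ) :
    phi l (PP V ys k) = phi l (PP U ys k) := by
  have h1 : MvPowerSeries.C T * PP V ys k = PP U ys k * MvPowerSeries.C T := by
    induction k with
    | zero => simp [PP]
    | succ k ih =>
      rw [PP, PP, mul_assoc, ← ih, ← mul_assoc, ← mul_assoc]
      congr 1
      ext d
      rw [MvPowerSeries.coeff_C_mul, MvPowerSeries.coeff_mul_C, coeff_gen, coeff_gen]
      split_ifs
      · exact H.TV _
      · simp
  ext d
  rw [coeff_phi, coeff_phi, ← H.lT, ← H.lT' (MvPowerSeries.coeff d (PP U ys k)),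
    ← MvPowerSeries.coeff_C_mul, h1, MvPowerSeries.coeff_mul_C]

theorem phi_main (H : OpData U V D T l) (xs ys : ℕ → σ) (m n : ℕ)
    (hx : ∀ i < m, ∀ k < i, xs i ≠ xs k) (hxy : ∀ i < m, ∀ j < n, xs i ≠ ys j) :
    phi l (PP U xs m * PP V ys n) * ∏ i ∈ Finset.range m, ((1 - MvPowerSeries.X (xs i)) *
      ∏ k ∈ Finset.range i, (1 - MvPowerSeries.X (xs i) * MvPowerSeries.X (xs k)))
    = phi l (PP V ys n) * ∏ i ∈ Finset.range m, ∏ j ∈ Finset.range n,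
      (1 + MvPowerSeries.X (xs i) * MvPowerSeries.X (ys j)) := by
  induction m with
  | zero => simp [PP]
  | succ m ih =>
    have ih' := ih (fun i hi => hx i (by omega)) (fun i hi => hxy i (by omega))
    rw [Finset.prod_range_succ, Finset.prod_range_succ, ← mul_assoc (phi l (PP V ys n)), ← ih']
    have h1 := phi_U H (xs m) (PP U xs m * PP V ys n)
    have h2 := rel_D_PPU H (xs m) xs m (hx m (by omega))
    have h3 := rel_D_PPV H (xs m) ys n (hxy m (by omega))
    set Q := ∏ k ∈ Finset.range m, (1 - MvPowerSeries.X (xs m) * MvPowerSeries.X (xs k) :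
      MvPowerSeries σ ℚ)
    set R := ∏ j ∈ Finset.range n, (1 + MvPowerSeries.X (xs m) * MvPowerSeries.X (ys j) :
      MvPowerSeries σ ℚ)
    have h4 : phi l (gen (xs m) D * (PP U xs m * PP V ys n)) * Q
        = phi l (PP U xs m * PP V ys n) * R := by
      rw [← phi_mul_cc, ← mul_assoc, mul_assoc _ (PP V ys n), ← cc_comm, ← mul_assoc, h2,
        mul_assoc, h3, ← mul_assoc, ← mul_assoc, phi_mul_cc, phi_D H]
    rw [PP, mul_assoc (gen _ U)]
    calc _ = (phi l (gen (xs m) U * (PP U xs m * PP V ys n)) * (1 - MvPowerSeries.X (xs m))) * Q *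
          ∏ i ∈ Finset.range m, ((1 - MvPowerSeries.X (xs i)) *
            ∏ k ∈ Finset.range i, (1 - MvPowerSeries.X (xs i) * MvPowerSeries.X (xs k))) := by ring
      _ = _ := by rw [h1, h4]; ring

theorem phi_final (H : OpData U V D T l) (hl : l 1 = 1) (xs ys : ℕ → σ) (m n : ℕ)
    (hx : ∀ i < m, ∀ k < i, xs i ≠ xs k) (hy : ∀ i < n, ∀ k < i, ys i ≠ ys k)
    (hxy : ∀ i < m, ∀ j < n, xs i ≠ ys j) :
    phi l (PP U xs m * PP V ys n) * (∏ i ∈ Finset.range m, ((1 - MvPowerSeries.X (xs i)) *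
      ∏ k ∈ Finset.range i, (1 - MvPowerSeries.X (xs i) * MvPowerSeries.X (xs k)))) *
      (∏ i ∈ Finset.range n, ((1 - MvPowerSeries.X (ys i)) *
      ∏ k ∈ Finset.range i, (1 - MvPowerSeries.X (ys i) * MvPowerSeries.X (ys k))))
    = ∏ i ∈ Finset.range m, ∏ j ∈ Finset.range n,
      (1 + MvPowerSeries.X (xs i) * MvPowerSeries.X (ys j)) := by
  rw [phi_main H xs ys m n hx hxy, phi_PPV H]
  have h := phi_main H ys ys n 0 hy (by simp)
  have h1 : phi l (PP V ys 0) = 1 := by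
    ext d
    rw [coeff_phi, PP, MvPowerSeries.coeff_one, MvPowerSeries.coeff_one]
    split_ifs <;> simp [hl]
  rw [h1, PP, mul_one] at h
  rw [mul_right_comm, h]
  simp

end Abstract


section Strips

open Classical in
/-- The Young diagram with given row lengths (junk if these are not a partition). -/
def ydMk (f : ℕ → ℕ) : YoungDiagram :=
  if h : Antitone f ∧ ∃ N, ∀ i, N ≤ i → f i = 0 then
    { cells := (Finset.range h.2.choose ×ˢ Finset.range (f 0)).filter fun c => c.2 < f c.1
      isLowerSet := by
        rintro ⟨a, b⟩ ⟨c, d⟩ hcd hab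
        have h1 : c ≤ a := hcd.1
        have h2 : d ≤ b := hcd.2
        simp only [Finset.coe_filter, Finset.mem_product, Finset.mem_range, Set.mem_setOf_eq] at hab ⊢
        have h3 := h.1 h1
        omega }
  else ⊥

theorem rowLen_ydMk (f : ℕ → ℕ) (h1 : ∀ i, f (i + 1) ≤ f i) (N : ℕ) (h2 : ∀ i, N ≤ i → f i = 0)
    (i : ℕ) : (ydMk f).rowLen i = f i := by
  have h : Antitone f ∧ ∃ N, ∀ i, N ≤ i → f i = 0 := ⟨antitone_nat_of_succ_le h1, N, h2⟩
  apply eq_of_forall_lt_iff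
  intro j
  rw [← YoungDiagram.mem_iff_lt_rowLen, ← YoungDiagram.mem_cells, ydMk, dif_pos h]
  simp only [Finset.mem_filter, Finset.mem_product, Finset.mem_range]
  constructor
  · exact fun h => h.2
  · intro h3
    refine ⟨⟨?_, lt_of_lt_of_le h3 (h.1 (Nat.zero_le i))⟩, h3⟩
    by_contra h4
    have := h.2.choose_spec i (by omega)
    omega

theorem yd_ext {a b : YoungDiagram} (h : ∀ i, a.rowLen i = b.rowLen i) : a = b := by
  apply SetLike.ext
  rintro ⟨i, j⟩
  rw [YoungDiagram.mem_iff_lt_rowLen, YoungDiagram.mem_iff_lt_rowLen, h]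

theorem yd_le_iff {a b : YoungDiagram} : a ≤ b ↔ ∀ i, a.rowLen i ≤ b.rowLen i := by
  constructor
  · intro h i
    by_contra h1
    have : (i, b.rowLen i) ∈ a := by rw [YoungDiagram.mem_iff_lt_rowLen]; omega
    have := h this
    rw [YoungDiagram.mem_iff_lt_rowLen] at this
    omega
  · rintro h ⟨i, j⟩ hc
    have := h i
    rw [YoungDiagram.mem_iff_lt_rowLen] at *
    omega

theorem rowLen_eq_zero (a : YoungDiagram) (i : ℕ) (h : a.colLen 0 ≤ i) : a.rowLen i = 0 := by
  by_contra h1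
  have : (i, 0) ∈ a := by rw [YoungDiagram.mem_iff_lt_rowLen]; omega
  rw [YoungDiagram.mem_iff_lt_colLen] at this
  omega

theorem yd_card (a : YoungDiagram) (N : ℕ) (h : a.colLen 0 ≤ N) :
    a.card = ∑ i ∈ Finset.range N, a.rowLen i := by
  rw [YoungDiagram.card, Finset.card_eq_sum_card_fiberwise (f := Prod.fst) (t := Finset.range N)]
  · apply Finset.sum_congr rfl
    intro i _
    rw [YoungDiagram.rowLen_eq_card]
    rfl
  · rintro ⟨i, j⟩ hc
    simp only [Finset.coe_range, Set.mem_Iio]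
    by_contra h1
    have := rowLen_eq_zero a i (by omega)
    have hc' : (i, j) ∈ a := hc
    rw [YoungDiagram.mem_iff_lt_rowLen] at hc'
    omega

theorem yd_card_change (a b : YoungDiagram) (i0 : ℕ) (h : ∀ i, i ≠ i0 → a.rowLen i = b.rowLen i) :
    a.card + b.rowLen i0 = b.card + a.rowLen i0 := by
  have ha := yd_card a (a.colLen 0 + b.colLen 0 + i0 + 1) (by omega)
  have hb := yd_card b (a.colLen 0 + b.colLen 0 + i0 + 1) (by omega)
  have hm : i0 ∈ Finset.range (a.colLen 0 + b.colLen 0 + i0 + 1) := by simp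
  rw [← Finset.add_sum_erase _ _ hm] at ha hb
  have : ∑ i ∈ (Finset.range (a.colLen 0 + b.colLen 0 + i0 + 1)).erase i0, a.rowLen i
    = ∑ i ∈ (Finset.range (a.colLen 0 + b.colLen 0 + i0 + 1)).erase i0, b.rowLen i :=
    Finset.sum_congr rfl fun i hi => h i (Finset.ne_of_mem_erase hi)
  omega

theorem yd_eq_of_le {a b : YoungDiagram} (h : a ≤ b) (hc : b.card ≤ a.card) : a = b := by
  apply YoungDiagram.ext
  exact Finset.eq_of_subset_of_card_le (YoungDiagram.cells_subset_iff.2 h) hc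

theorem yd_transpose_card (a : YoungDiagram) : a.transpose.card = a.card := by
  simp [YoungDiagram.card, YoungDiagram.transpose]

theorem yd_finite (N : ℕ) : {a : YoungDiagram | a.card ≤ N}.Finite := by
  apply Set.Finite.of_finite_image (f := YoungDiagram.cells)
  · apply (Finset.finite_toSet (Finset.range N ×ˢ Finset.range N).powerset).subset
    rintro _ ⟨a, ha, rfl⟩
    simp only [Finset.coe_powerset, Set.mem_preimage, Set.mem_powerset_iff, Finset.coe_subset]
    rintro ⟨i, j⟩ hc
    have ha' : a.card ≤ N := ha
    have h1 : (i, j) ∈ a := hc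
    have h2 := h1
    rw [YoungDiagram.mem_iff_lt_rowLen, YoungDiagram.rowLen_eq_card] at h1
    rw [YoungDiagram.mem_iff_lt_colLen, YoungDiagram.colLen_eq_card] at h2
    have h3 : (a.row i).card ≤ a.card := Finset.card_filter_le _ _
    have h4 : (a.col j).card ≤ a.card := Finset.card_filter_le _ _
    simp only [Finset.mem_product, Finset.mem_range]
    omega
  · intro a _ b _ h
    exact YoungDiagram.ext h

/-- All Young diagrams with at most `N` cells. -/
def upTo (N : ℕ) : Finset YoungDiagram := (yd_finite N).toFinset

theorem mem_upTo {N : ℕ} {a : YoungDiagram} : a ∈ upTo N ↔ a.card ≤ N := by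
  simp [upTo]

/-- `b / a` is a horizontal strip. -/
def HS (a b : YoungDiagram) : Prop := ∀ i, a.rowLen i ≤ b.rowLen i ∧ b.rowLen (i + 1) ≤ a.rowLen i

/-- `b / a` is a vertical strip. -/
def VS (a b : YoungDiagram) : Prop := ∀ i, a.rowLen i ≤ b.rowLen i ∧ b.rowLen i ≤ a.rowLen i + 1

theorem HS.le {a b : YoungDiagram} (h : HS a b) : a ≤ b := yd_le_iff.2 fun i => (h i).1

theorem VS.le {a b : YoungDiagram} (h : VS a b) : a ≤ b := yd_le_iff.2 fun i => (h i).1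

theorem hs_refl (a : YoungDiagram) : HS a a := fun i => ⟨le_rfl, a.rowLen_anti _ _ (by omega)⟩

theorem hs_iff {a b : YoungDiagram} : HS a b ↔ a ≤ b ∧ ∀ i j, (i + 1, j) ∈ b → (i, j) ∈ a := by
  constructor
  · intro h
    refine ⟨h.le, fun i j hij => ?_⟩
    have := h i
    rw [YoungDiagram.mem_iff_lt_rowLen] at *
    omega
  · rintro ⟨h1, h2⟩ i
    refine ⟨yd_le_iff.1 h1 i, ?_⟩
    by_contra h3
    have := h2 i (a.rowLen i)
    rw [YoungDiagram.mem_iff_lt_rowLen, YoungDiagram.mem_iff_lt_rowLen] at this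
    omega

theorem vs_iff {a b : YoungDiagram} : VS a b ↔ a ≤ b ∧ ∀ i j, (i, j + 1) ∈ b → (i, j) ∈ a := by
  constructor
  · intro h
    refine ⟨h.le, fun i j hij => ?_⟩
    have := h i
    rw [YoungDiagram.mem_iff_lt_rowLen] at *
    omega
  · rintro ⟨h1, h2⟩ i
    refine ⟨yd_le_iff.1 h1 i, ?_⟩
    by_contra h3
    have := h2 i (a.rowLen i)
    rw [YoungDiagram.mem_iff_lt_rowLen, YoungDiagram.mem_iff_lt_rowLen] at this
    omega

theorem vs_transpose {a b : YoungDiagram} : VS a.transpose b.transpose ↔ HS a b := by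
  rw [vs_iff, hs_iff, YoungDiagram.transpose_le_iff]
  simp only [YoungDiagram.mem_transpose, Prod.swap_prod_mk]
  constructor
  · exact fun h => ⟨h.1, fun i j => h.2 j i⟩
  · exact fun h => ⟨h.1, fun i j => h.2 j i⟩

open Classical in
/-- Diagrams obtained by adding a horizontal strip of size `k`. -/
def upS (k : ℕ) (a : YoungDiagram) : Finset YoungDiagram :=
  (upTo (a.card + k)).filter fun b => HS a b ∧ b.card = a.card + k

open Classical in
/-- Diagrams obtained by adding a vertical strip of size `k`. -/
def vuS (k : ℕ) (a : YoungDiagram) : Finset YoungDiagram :=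
  (upTo (a.card + k)).filter fun b => VS a b ∧ b.card = a.card + k

open Classical in
/-- Diagrams obtained by removing a horizontal strip of size `k`. -/
def dnS (k : ℕ) (a : YoungDiagram) : Finset YoungDiagram :=
  (upTo a.card).filter fun b => HS b a ∧ b.card + k = a.card

theorem mem_upS {k : ℕ} {a b : YoungDiagram} : b ∈ upS k a ↔ HS a b ∧ b.card = a.card + k := by
  simp only [upS, Finset.mem_filter, mem_upTo]
  constructor
  · exact fun h => h.2
  · exact fun h => ⟨h.2.le, h⟩

theorem mem_vuS {k : ℕ} {a b : YoungDiagram} : b ∈ vuS k a ↔ VS a b ∧ b.card = a.card + k := by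
  simp only [vuS, Finset.mem_filter, mem_upTo]
  constructor
  · exact fun h => h.2
  · exact fun h => ⟨h.2.le, h⟩

theorem mem_dnS {k : ℕ} {a b : YoungDiagram} : b ∈ dnS k a ↔ HS b a ∧ b.card + k = a.card := by
  simp only [dnS, Finset.mem_filter, mem_upTo]
  constructor
  · exact fun h => h.2
  · exact fun h => ⟨by omega, h⟩

theorem sum_reflect (l m v c : ℕ → ℕ) (h0 : v 0 = max (l 0) (m 0))
    (h : ∀ i, c i + v (i + 1) = min (l i) (m i) + max (l (i + 1)) (m (i + 1))) (n : ℕ) :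
    ∑ i ∈ Finset.range n, c i + ∑ i ∈ Finset.range (n + 1), v i
    = ∑ i ∈ Finset.range n, l i + ∑ i ∈ Finset.range n, m i + max (l n) (m n) := by
  induction n with
  | zero => simp [h0]
  | succ n ih =>
    have := h n
    rw [Finset.sum_range_succ, Finset.sum_range_succ _ (n + 1), Finset.sum_range_succ l,
      Finset.sum_range_succ m]
    omega

theorem card_reflect (l m v c : YoungDiagram) (h0 : v.rowLen 0 = max (l.rowLen 0) (m.rowLen 0))
    (h : ∀ i, c.rowLen i + v.rowLen (i + 1) =
      min (l.rowLen i) (m.rowLen i) + max (l.rowLen (i + 1)) (m.rowLen (i + 1))) :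
    c.card + v.card = l.card + m.card := by
  have h1 := sum_reflect _ _ _ _ h0 h (l.colLen 0 + m.colLen 0 + v.colLen 0 + c.colLen 0)
  rw [← yd_card c _ (by omega), ← yd_card v _ (by omega), ← yd_card l _ (by omega),
    ← yd_card m _ (by omega), rowLen_eq_zero l _ (by omega), rowLen_eq_zero m _ (by omega)] at h1
  simpa using h1

/-- Row lengths of the reflected diagram (downwards). -/
def dnF (l m v : YoungDiagram) (i : ℕ) : ℕ := min (l.rowLen i) (m.rowLen i) +
  max (l.rowLen (i + 1)) (m.rowLen (i + 1)) - v.rowLen (i + 1)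

/-- Row lengths of the reflected diagram (upwards). -/
def upF (l m c : YoungDiagram) (i : ℕ) : ℕ :=
  if i = 0 then max (l.rowLen 0) (m.rowLen 0) else
    min (l.rowLen (i - 1)) (m.rowLen (i - 1)) + max (l.rowLen i) (m.rowLen i) - c.rowLen (i - 1)

theorem row_dnF (l m v : YoungDiagram) (h1 : HS l v) (h2 : HS m v) (i : ℕ) :
    (ydMk (dnF l m v)).rowLen i = dnF l m v i := by
  apply rowLen_ydMk _ _ (l.colLen 0 + m.colLen 0)
  · intro i hi
    simp [dnF, rowLen_eq_zero l i (by omega), rowLen_eq_zero l (i + 1) (by omega),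
      rowLen_eq_zero m (i + 1) (by omega)]
  · intro i
    have a1 := h1 i; have a2 := h1 (i + 1); have a3 := h1 (i + 1 + 1)
    have b1 := h2 i; have b2 := h2 (i + 1); have b3 := h2 (i + 1 + 1)
    unfold dnF
    omega

theorem row_upF (l m c : YoungDiagram) (h1 : HS c l) (h2 : HS c m) (i : ℕ) :
    (ydMk (upF l m c)).rowLen i = upF l m c i := by
  apply rowLen_ydMk _ _ (l.colLen 0 + m.colLen 0 + 1)
  · intro i hi
    simp [upF, rowLen_eq_zero l i (by omega), rowLen_eq_zero l (i - 1) (by omega),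
      rowLen_eq_zero m i (by omega)]
    omega
  · intro i
    rcases i with _ | i
    · have a1 := h1 0; have b1 := h2 0; simp only [zero_add] at a1 b1
      simp only [upF]
      simp
      omega
    · have a1 := h1 i; have a2 := h1 (i + 1); have a3 := h1 (i + 1 + 1)
      have b1 := h2 i; have b2 := h2 (i + 1); have b3 := h2 (i + 1 + 1)
      simp [upF]
      omega

theorem dn_reflect (l m v : YoungDiagram) (h1 : HS l v) (h2 : HS m v)
    (h0 : v.rowLen 0 = max (l.rowLen 0) (m.rowLen 0)) :
    HS (ydMk (dnF l m v)) l ∧ HS (ydMk (dnF l m v)) m ∧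
    (ydMk (dnF l m v)).card + v.card = l.card + m.card ∧
    ydMk (upF l m (ydMk (dnF l m v))) = v := by
  have hr := row_dnF l m v h1 h2
  have k1 : HS (ydMk (dnF l m v)) l := by
    intro i
    have a1 := h1 i; have a2 := h1 (i + 1)
    have b1 := h2 i; have b2 := h2 (i + 1)
    rw [hr]; unfold dnF; omega
  have k2 : HS (ydMk (dnF l m v)) m := by
    intro i
    have a1 := h1 i; have a2 := h1 (i + 1)
    have b1 := h2 i; have b2 := h2 (i + 1)
    rw [hr]; unfold dnF; omega
  refine ⟨k1, k2, ?_, ?_⟩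
  · apply card_reflect _ _ _ _ h0
    intro i
    have a1 := h1 i; have a2 := h1 (i + 1)
    have b1 := h2 i; have b2 := h2 (i + 1)
    rw [hr]; unfold dnF; omega
  · apply yd_ext
    intro i
    rw [row_upF l m _ k1 k2]
    rcases i with _ | i
    · simp [upF, h0]
    · have a1 := h1 i; have a2 := h1 (i + 1)
      have b1 := h2 i; have b2 := h2 (i + 1)
      simp only [upF, Nat.add_sub_cancel, hr, dnF]
      simp
      omega

theorem up_reflect (l m c : YoungDiagram) (h1 : HS c l) (h2 : HS c m) :
    HS l (ydMk (upF l m c)) ∧ HS m (ydMk (upF l m c)) ∧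
    (ydMk (upF l m c)).rowLen 0 = max (l.rowLen 0) (m.rowLen 0) ∧
    c.card + (ydMk (upF l m c)).card = l.card + m.card ∧
    ydMk (dnF l m (ydMk (upF l m c))) = c := by
  have hr := row_upF l m c h1 h2
  have k1 : HS l (ydMk (upF l m c)) := by
    intro i
    rw [hr, hr]
    rcases i with _ | i
    · have a1 := h1 0; have b1 := h2 0; simp only [zero_add] at a1 b1
      simp [upF]; omega
    · have a1 := h1 i; have a2 := h1 (i + 1)
      have b1 := h2 i; have b2 := h2 (i + 1)
      simp [upF]; omega
  have k2 : HS m (ydMk (upF l m c)) := by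
    intro i
    rw [hr, hr]
    rcases i with _ | i
    · have a1 := h1 0; have b1 := h2 0; simp only [zero_add] at a1 b1
      simp [upF]; omega
    · have a1 := h1 i; have a2 := h1 (i + 1)
      have b1 := h2 i; have b2 := h2 (i + 1)
      simp [upF]; omega
  have k0 : (ydMk (upF l m c)).rowLen 0 = max (l.rowLen 0) (m.rowLen 0) := by
    rw [hr]; simp [upF]
  refine ⟨k1, k2, k0, ?_, ?_⟩
  · apply card_reflect _ _ _ _ k0
    intro i
    have a1 := h1 i; have b1 := h2 i
    rw [hr]; simp [upF]; omega
  · apply yd_ext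
    intro i
    rw [row_dnF l m _ k1 k2]
    have a1 := h1 i; have b1 := h2 i
    simp only [dnF, hr, upF]
    simp
    omega

/-- Change the first row. -/
def row0 (v : YoungDiagram) (a : ℕ) (i : ℕ) : ℕ := if i = 0 then a else v.rowLen i

theorem row_row0 (v : YoungDiagram) (a : ℕ) (h : v.rowLen 1 ≤ a) (i : ℕ) :
    (ydMk (row0 v a)).rowLen i = row0 v a i := by
  apply rowLen_ydMk _ _ (v.colLen 0 + 1)
  · intro i hi
    simp [row0, rowLen_eq_zero v i (by omega)]
    omega
  · intro i
    rcases i with _ | i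
    · simpa [row0] using h
    · simpa [row0] using v.rowLen_anti (i + 1) (i + 1 + 1) (by omega)

theorem hs_row0 (l v : YoungDiagram) (a : ℕ) (h : HS l v) (ha : l.rowLen 0 ≤ a) :
    HS l (ydMk (row0 v a)) := by
  have h0 := h 0
  simp only [zero_add] at h0
  intro i
  rw [row_row0 v a (by omega), row_row0 v a (by omega)]
  have := h i
  rcases i with _ | i
  · simp [row0]; simp at this; omega
  · simpa [row0] using this

theorem card_row0 (v : YoungDiagram) (a : ℕ) (h : v.rowLen 1 ≤ a) :
    (ydMk (row0 v a)).card + v.rowLen 0 = v.card + a := by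
  have := yd_card_change (ydMk (row0 v a)) v 0 (by
    intro i hi
    rw [row_row0 v a h]; simp [row0, hi])
  rw [row_row0 v a h] at this
  simpa [row0] using this

open Classical in
theorem count_DU (l m : YoungDiagram) (j k : ℕ) :
    ((upS (k + 1) l).filter fun v => m ∈ dnS (j + 1) v).card
    = ((dnS (j + 1) l).filter fun c => m ∈ upS (k + 1) c).card
      + ((upS k l).filter fun v => m ∈ dnS j v).card := by
  rw [← Finset.card_filter_add_card_filter_not
    (fun v : YoungDiagram => v.rowLen 0 = max (l.rowLen 0) (m.rowLen 0))]
  congr 1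
  · apply Finset.card_nbij' (fun v => ydMk (dnF l m v)) (fun c => ydMk (upF l m c))
    · intro v hv
      simp only [Finset.coe_filter, Finset.mem_filter, mem_upS, mem_dnS, Set.mem_setOf_eq] at hv ⊢
      obtain ⟨⟨⟨h1, h2⟩, h3, h4⟩, h0⟩ := hv
      obtain ⟨k1, k2, k3, k4⟩ := dn_reflect l m v h1 h3 h0
      refine ⟨⟨k1, ?_⟩, k2, ?_⟩ <;> omega
    · intro v hv
      simp only [Finset.coe_filter, Finset.mem_filter, mem_upS, mem_dnS, Set.mem_setOf_eq] at hv ⊢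
      obtain ⟨⟨h1, h2⟩, h3, h4⟩ := hv
      obtain ⟨k1, k2, k0, k3, k4⟩ := up_reflect l m v h1 h3
      refine ⟨⟨⟨k1, ?_⟩, k2, ?_⟩, k0⟩ <;> omega
    · intro v hv
      simp only [Finset.coe_filter, Finset.mem_filter, mem_upS, mem_dnS, Set.mem_setOf_eq] at hv ⊢
      obtain ⟨⟨⟨h1, h2⟩, h3, h4⟩, h0⟩ := hv
      exact (dn_reflect l m v h1 h3 h0).2.2.2
    · intro v hv
      simp only [Finset.coe_filter, Finset.mem_filter, mem_upS, mem_dnS, Set.mem_setOf_eq] at hv ⊢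
      obtain ⟨⟨h1, h2⟩, h3, h4⟩ := hv
      exact (up_reflect l m v h1 h3).2.2.2.2
  · apply Finset.card_nbij' (fun v => ydMk (row0 v (v.rowLen 0 - 1)))
      (fun v => ydMk (row0 v (v.rowLen 0 + 1)))
    · intro v hv
      simp only [Finset.coe_filter, Finset.mem_filter, mem_upS, mem_dnS, Set.mem_setOf_eq] at hv ⊢
      obtain ⟨⟨⟨h1, h2⟩, h3, h4⟩, h0⟩ := hv
      have a1 := h1 0; have a2 := h3 0
      simp only [zero_add] at a1 a2
      have := card_row0 v (v.rowLen 0 - 1) (by omega)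
      refine ⟨⟨hs_row0 _ _ _ h1 (by omega), ?_⟩, hs_row0 _ _ _ h3 (by omega), ?_⟩ <;> omega
    · intro v hv
      simp only [Finset.coe_filter, Finset.mem_filter, mem_upS, mem_dnS, Set.mem_setOf_eq] at hv ⊢
      obtain ⟨⟨h1, h2⟩, h3, h4⟩ := hv
      have a1 := h1 0; have a2 := h3 0
      simp only [zero_add] at a1 a2
      have := card_row0 v (v.rowLen 0 + 1) (by omega)
      refine ⟨⟨⟨hs_row0 _ _ _ h1 (by omega), ?_⟩, hs_row0 _ _ _ h3 (by omega), ?_⟩, ?_⟩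
      · omega
      · omega
      · rw [row_row0 v _ (by omega)]; simp [row0]; omega
    · intro v hv
      simp only [Finset.coe_filter, Finset.mem_filter, mem_upS, mem_dnS, Set.mem_setOf_eq] at hv ⊢
      obtain ⟨⟨⟨h1, h2⟩, h3, h4⟩, h0⟩ := hv
      have a1 := h1 0; have a2 := h3 0
      simp only [zero_add] at a1 a2
      have hr := row_row0 v (v.rowLen 0 - 1) (by omega)
      apply yd_ext
      intro i
      rw [row_row0 _ _ (by rw [hr, hr]; simp [row0]; omega)]
      simp only [row0]
      split_ifs with hi
      · subst hi; rw [hr]; simp [row0]; omega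
      · rw [hr]; simp [row0, hi]
    · intro v hv
      simp only [Finset.coe_filter, Finset.mem_filter, mem_upS, mem_dnS, Set.mem_setOf_eq] at hv ⊢
      obtain ⟨⟨h1, h2⟩, h3, h4⟩ := hv
      have a1 := h1 0; have a2 := h3 0
      simp only [zero_add] at a1 a2
      have hr := row_row0 v (v.rowLen 0 + 1) (by omega)
      apply yd_ext
      intro i
      rw [row_row0 _ _ (by rw [hr, hr]; simp [row0]; omega)]
      simp only [row0]
      split_ifs with hi
      · subst hi; rw [hr]; simp [row0]
      · rw [hr]; simp [row0, hi]

/-- Change one row. -/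
theorem exists_toggle (l m : YoungDiagram) (h : l.card < m.card) :
    ∃ i0, l.rowLen i0 < m.rowLen i0 ∧ ∀ i, i0 < i → m.rowLen i ≤ l.rowLen i := by
  have hne : ((Finset.range (m.colLen 0)).filter fun i => l.rowLen i < m.rowLen i).Nonempty := by
    rw [Finset.nonempty_iff_ne_empty]
    intro h0
    rw [Finset.filter_eq_empty_iff] at h0
    have : m ≤ l := by
      rw [yd_le_iff]
      intro i
      by_cases hi : i < m.colLen 0
      · have := h0 (Finset.mem_range.2 hi); omega
      · rw [rowLen_eq_zero m i (by omega)]; omega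
    have := Finset.card_le_card (YoungDiagram.cells_subset_iff.2 this)
    simp only [YoungDiagram.card] at h
    omega
  refine ⟨_, (Finset.mem_filter.1 (Finset.max'_mem _ hne)).2, ?_⟩
  intro i hi
  by_contra h1
  have : i ∈ (Finset.range (m.colLen 0)).filter fun i => l.rowLen i < m.rowLen i := by
    rw [Finset.mem_filter, Finset.mem_range]
    refine ⟨?_, by omega⟩
    by_contra h2
    rw [rowLen_eq_zero m i (by omega)] at h1
    omega
  have := Finset.le_max' _ _ this
  omega

/-- Toggle the cell in row `i0` of the vertical strip over `l`. -/
def togF (l v : YoungDiagram) (i0 i : ℕ) : ℕ :=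
  if i = i0 then 2 * l.rowLen i0 + 1 - v.rowLen i0 else v.rowLen i

theorem tog_spec (l m v : YoungDiagram) (i0 : ℕ) (h0 : l.rowLen i0 < m.rowLen i0)
    (h1 : ∀ i, i0 < i → m.rowLen i ≤ l.rowLen i) (hv : VS l v) (hh : HS v m) :
    VS l (ydMk (togF l v i0)) ∧ HS (ydMk (togF l v i0)) m ∧
    (∀ i, (ydMk (togF l v i0)).rowLen i = togF l v i0 i) := by
  have b0 := hv i0
  have c0 := h1 (i0 + 1) (by omega)
  have c1 := l.rowLen_anti i0 (i0 + 1) (by omega)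
  have key : ∀ i, togF l v i0 i ≤ m.rowLen i ∧ m.rowLen (i + 1) ≤ togF l v i0 i := by
    intro i
    have a0 := hh i
    unfold togF
    split_ifs with hi
    · subst hi; omega
    · exact a0
  have hr : ∀ i, (ydMk (togF l v i0)).rowLen i = togF l v i0 i := by
    apply rowLen_ydMk _ _ (m.colLen 0)
    · intro i hi
      have := (key i).1
      rw [rowLen_eq_zero m i hi] at this
      omega
    · intro i
      have := key i; have := key (i + 1); omega
  refine ⟨?_, ?_, hr⟩
  · intro i
    have := hv i
    rw [hr]; unfold togF
    split_ifs with hi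
    · subst hi; omega
    · exact this
  · intro i
    rw [hr]; exact key i

open Classical in
theorem sum_toggle (l m : YoungDiagram) (h : l.card < m.card) :
    ∑ v ∈ (upTo m.card).filter (fun v => VS l v ∧ HS v m), (-1 : ℚ) ^ (m.card - v.card) = 0 := by
  obtain ⟨i0, h0, h1⟩ := exists_toggle l m h
  apply Finset.sum_involution (fun v _ => ydMk (togF l v i0))
  · intro v hv
    simp only [Finset.mem_filter, mem_upTo] at hv
    obtain ⟨k1, k2, k3⟩ := tog_spec l m v i0 h0 h1 hv.2.1 hv.2.2
    have hc := yd_card_change (ydMk (togF l v i0)) v i0 (by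
      intro i hi; rw [k3]; simp [togF, hi])
    have b0 := hv.2.1 i0
    have e1 : (ydMk (togF l v i0)).card ≤ m.card :=
      Finset.card_le_card (YoungDiagram.cells_subset_iff.2 k2.le)
    rw [k3] at hc
    simp only [togF, if_true] at hc
    rcases (by omega : v.rowLen i0 = l.rowLen i0 ∨ v.rowLen i0 = l.rowLen i0 + 1) with h2 | h2
    · rw [show m.card - v.card = m.card - (ydMk (togF l v i0)).card + 1 by omega, pow_succ]
      ring
    · rw [show m.card - (ydMk (togF l v i0)).card = m.card - v.card + 1 by omega, pow_succ]
      ring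
  · intro v hv _ heq
    simp only [Finset.mem_filter, mem_upTo] at hv
    obtain ⟨k1, k2, k3⟩ := tog_spec l m v i0 h0 h1 hv.2.1 hv.2.2
    have := k3 i0
    rw [heq] at this
    simp only [togF, if_true] at this
    have b0 := hv.2.1 i0
    omega
  · intro v hv
    simp only [Finset.mem_filter, mem_upTo] at hv ⊢
    obtain ⟨k1, k2, k3⟩ := tog_spec l m v i0 h0 h1 hv.2.1 hv.2.2
    exact ⟨Finset.card_le_card (YoungDiagram.cells_subset_iff.2 k2.le), k1, k2⟩
  · intro v hv
    simp only [Finset.mem_filter, mem_upTo] at hv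
    obtain ⟨k1, k2, k3⟩ := tog_spec l m v i0 h0 h1 hv.2.1 hv.2.2
    obtain ⟨j1, j2, j3⟩ := tog_spec l m _ i0 h0 h1 k1 k2
    apply yd_ext
    intro i
    rw [j3]
    have b0 := hv.2.1 i0
    simp only [togF, k3]
    split_ifs with hi
    · subst hi; omega
    · rfl

end Strips


section Ops

/-- The space spanned by Young diagrams. -/
abbrev YV : Type := YoungDiagram →₀ ℚ

/-- The operator sending a diagram to the sum of the diagrams in `S a`. -/
def opS (S : YoungDiagram → Finset YoungDiagram) : Module.End ℚ YV :=
  Finsupp.linearCombination ℚ (fun a => ∑ b ∈ S a, Finsupp.single b (1 : ℚ))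

theorem opS_single (S : YoungDiagram → Finset YoungDiagram) (a : YoungDiagram) :
    opS S (Finsupp.single a 1) = ∑ b ∈ S a, Finsupp.single b (1 : ℚ) := by
  simp [opS]

open Classical in
theorem opS_single_apply (S : YoungDiagram → Finset YoungDiagram) (a b : YoungDiagram) :
    opS S (Finsupp.single a 1) b = if b ∈ S a then 1 else 0 := by
  rw [opS_single, Finsupp.finsetSum_apply]
  simp [Finsupp.single_apply]

open Classical in
theorem opS_mul_apply (S S' : YoungDiagram → Finset YoungDiagram) (a b : YoungDiagram) :
    (opS S * opS S') (Finsupp.single a 1) b = (((S' a).filter fun v => b ∈ S v).card : ℚ) := by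
  rw [Module.End.mul_apply, opS_single S', map_sum, Finsupp.finsetSum_apply]
  simp [opS_single_apply]

theorem end_ext {f g : Module.End ℚ YV}
    (h : ∀ a b, f (Finsupp.single a 1) b = g (Finsupp.single a 1) b) : f = g := by
  apply Finsupp.lhom_ext'
  intro a
  apply LinearMap.ext_ring
  ext b
  exact h a b

/-- Adding horizontal strips. -/
def opU (k : ℕ) : Module.End ℚ YV := opS (upS k)
/-- Adding vertical strips. -/
def opV (k : ℕ) : Module.End ℚ YV := opS (vuS k)
/-- Removing horizontal strips. -/
def opD (k : ℕ) : Module.End ℚ YV := opS (dnS k)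
/-- Conjugation. -/
def opT : Module.End ℚ YV := Finsupp.lmapDomain ℚ ℚ YoungDiagram.transpose

theorem upS_zero (a : YoungDiagram) : upS 0 a = {a} := by
  ext b
  rw [mem_upS, Finset.mem_singleton]
  constructor
  · rintro ⟨h1, h2⟩; exact (yd_eq_of_le h1.le (by omega)).symm
  · rintro rfl; exact ⟨hs_refl _, rfl⟩

theorem dnS_zero (a : YoungDiagram) : dnS 0 a = {a} := by
  ext b
  rw [mem_dnS, Finset.mem_singleton]
  constructor
  · rintro ⟨h1, h2⟩; exact (yd_eq_of_le h1.le (by omega))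
  · rintro rfl; exact ⟨hs_refl _, rfl⟩

theorem opU_zero : opU 0 = 1 := by
  apply end_ext
  intro a b
  rw [opU, opS_single, upS_zero]; simp

theorem opD_zero : opD 0 = 1 := by
  apply end_ext
  intro a b
  rw [opD, opS_single, dnS_zero]; simp

theorem opT_single (a : YoungDiagram) :
    opT (Finsupp.single a 1) = Finsupp.single a.transpose (1 : ℚ) := by
  simp [opT]

theorem opT_mul_opT : opT * opT = 1 := by
  apply end_ext
  intro a b
  rw [Module.End.mul_apply, opT_single, opT_single]; simp

theorem opT_V (k : ℕ) : opT * opV k = opU k * opT := by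
  apply end_ext
  intro a b
  congr 1
  rw [Module.End.mul_apply, Module.End.mul_apply, opT_single, opV, opU, opS_single, opS_single, map_sum]
  simp only [opT_single]
  apply Finset.sum_nbij' YoungDiagram.transpose YoungDiagram.transpose
  · intro v hv
    rw [mem_vuS] at hv
    rw [mem_upS, ← vs_transpose, yd_transpose_card, yd_transpose_card]
    simpa using hv
  · intro v hv
    rw [mem_upS, ← vs_transpose, yd_transpose_card] at hv
    rw [mem_vuS, yd_transpose_card]
    simpa using hv
  · simp
  · simp
  · simp

theorem opT_U (k : ℕ) : opT * opU k = opV k * opT := by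
  have h := opT_V k
  calc opT * opU k = opT * (opU k * opT) * opT := by
        rw [mul_assoc, mul_assoc, opT_mul_opT, mul_one]
    _ = opV k * opT := by rw [← h, ← mul_assoc, opT_mul_opT, one_mul]

theorem op_DU (j k : ℕ) : opD (j + 1) * opU (k + 1) = opU (k + 1) * opD (j + 1) + opD j * opU k := by
  apply end_ext
  intro a b
  rw [LinearMap.add_apply, Finsupp.add_apply, opD, opD, opU, opU, opS_mul_apply, opS_mul_apply,
    opS_mul_apply, count_DU]
  push_cast
  rfl

theorem neg_pow_apply (k : ℕ) (f : Module.End ℚ YV) (v : YV) (b : YoungDiagram) :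
    (((-1 : Module.End ℚ YV) ^ k * f) v) b = (-1 : ℚ) ^ k * f v b := by
  induction k with
  | zero => simp
  | succ k ih =>
    rw [pow_succ', mul_assoc, Module.End.mul_apply, LinearMap.neg_apply, Module.End.one_apply,
      Finsupp.neg_apply, ih, pow_succ']
    ring

open Classical in
theorem op_UV (n : ℕ) : ∑ p ∈ Finset.HasAntidiagonal.antidiagonal n,
    ((-1 : Module.End ℚ YV) ^ p.1 * opU p.1) * opV p.2 = if n = 0 then 1 else 0 := by
  rcases Nat.eq_zero_or_pos n with hn | hn
  · subst hn
    have h0 : opV 0 = 1 := by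
      have h := opT_U 0
      rw [opU_zero, mul_one] at h
      have := congrArg (· * opT) h
      simpa [mul_assoc, opT_mul_opT] using this.symm
    simp [opU_zero, h0]
  rw [if_neg (by omega)]
  apply end_ext
  intro l m
  rw [LinearMap.sum_apply, Finsupp.finsetSum_apply, LinearMap.zero_apply, Finsupp.zero_apply]
  simp only [mul_assoc, neg_pow_apply]
  simp only [opU, opV, opS_mul_apply]
  by_cases hc : m.card = l.card + n
  · rw [← sum_toggle l m (by omega)]
    have : ∀ p ∈ Finset.HasAntidiagonal.antidiagonal n,
        (-1 : ℚ) ^ p.1 * (((vuS p.2 l).filter fun v => m ∈ upS p.1 v).card : ℚ)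
        = ∑ v ∈ ((upTo m.card).filter (fun v => VS l v ∧ HS v m)).filter
            (fun v => (m.card - v.card, v.card - l.card) = p), (-1 : ℚ) ^ (m.card - v.card) := by
      rintro ⟨p, q⟩ hp
      rw [Finset.HasAntidiagonal.mem_antidiagonal] at hp
      simp only at hp
      rw [Finset.sum_congr rfl (g := fun _ => (-1 : ℚ) ^ p), Finset.sum_const, nsmul_eq_mul, mul_comm]
      · congr 2
        congr 1
        ext v
        simp only [Finset.mem_filter, mem_vuS, mem_upS, mem_upTo, Prod.mk.injEq]
        constructor
        · rintro ⟨⟨h1, h2⟩, h3, h4⟩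
          refine ⟨⟨by omega, h1, h3⟩, by omega, by omega⟩
        · rintro ⟨⟨h0, h1, h2⟩, h3, h4⟩
          have h5 : l.card ≤ v.card := Finset.card_le_card (YoungDiagram.cells_subset_iff.2 h1.le)
          refine ⟨⟨h1, by omega⟩, h2, by omega⟩
      · intro v hv
        simp only [Finset.mem_filter, Prod.mk.injEq] at hv
        rw [hv.2.1]
    rw [Finset.sum_congr rfl this]
    apply Finset.sum_fiberwise_of_maps_to
    intro v hv
    simp only [Finset.mem_filter, mem_upTo] at hv
    rw [Finset.HasAntidiagonal.mem_antidiagonal]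
    have h5 : l.card ≤ v.card := Finset.card_le_card (YoungDiagram.cells_subset_iff.2 hv.2.1.le)
    simp only
    omega
  · apply Finset.sum_eq_zero
    rintro ⟨p, q⟩ hp
    rw [Finset.HasAntidiagonal.mem_antidiagonal] at hp
    simp only at hp
    rw [Finset.filter_eq_empty_iff.2]
    · simp
    · intro v hv h
      rw [mem_vuS] at hv
      rw [mem_upS] at h
      omega

theorem op_VU (n : ℕ) : ∑ p ∈ Finset.HasAntidiagonal.antidiagonal n,
    opV p.1 * ((-1 : Module.End ℚ YV) ^ p.2 * opU p.2) = if n = 0 then 1 else 0 := by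
  have hV : ∀ k, opV k = opT * opU k * opT := fun k => by
    rw [opT_U, mul_assoc, opT_mul_opT, mul_one]
  have hU : ∀ k, opU k = opT * opV k * opT := fun k => by
    rw [opT_V, mul_assoc, opT_mul_opT, mul_one]
  have hc : ∀ k (a : Module.End ℚ YV), (-1 : Module.End ℚ YV) ^ k * a = a * (-1) ^ k := fun k a =>
    ((Commute.neg_one_left a).pow_left k).eq
  have key : ∀ p ∈ Finset.HasAntidiagonal.antidiagonal n,
      opV p.1 * ((-1 : Module.End ℚ YV) ^ p.2 * opU p.2) =
      (-1) ^ n * (opT * (((-1 : Module.End ℚ YV) ^ p.1 * opU p.1) * opV p.2) * opT) := by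
    rintro ⟨p, q⟩ hp
    rw [Finset.HasAntidiagonal.mem_antidiagonal] at hp
    simp only at hp ⊢
    have e1 : opV p * opU q = opT * (opU p * opV q) * opT := by
      rw [hV p, hU q]
      calc _ = opT * opU p * (opT * opT) * opV q * opT := by simp only [mul_assoc]
        _ = _ := by rw [opT_mul_opT]; simp only [mul_assoc, mul_one]
    calc opV p * ((-1) ^ q * opU q) = (-1) ^ q * (opV p * opU q) := by
          rw [← mul_assoc, ← hc, mul_assoc]
      _ = ((-1) ^ n * (-1) ^ p) * (opT * (opU p * opV q) * opT) := by
          have hs : (-1 : Module.End ℚ YV) ^ n * (-1) ^ p = (-1) ^ q := by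
            have h2 : (-1 : Module.End ℚ YV) ^ (2 * p) = 1 := by
              apply end_ext
              intro a b
              have := neg_pow_apply (2 * p) 1 (Finsupp.single a 1) b
              rw [mul_one] at this
              rw [this]; simp
            rw [← hp, ← pow_add, show p + q + p = q + 2 * p by ring, pow_add, h2, mul_one]
          rw [hs, e1]
      _ = _ := by
          rw [mul_assoc, ← mul_assoc ((-1) ^ p), ← mul_assoc ((-1) ^ p) opT, hc p opT]
          simp only [mul_assoc]
  rw [Finset.sum_congr rfl key, ← Finset.mul_sum, ← Finset.sum_mul, ← Finset.mul_sum, op_UV]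
  split_ifs with h
  · subst h; simp [opT_mul_opT]
  · simp

/-- The sum of all coefficients. -/
def epsY : YV →ₗ[ℚ] ℚ := Finsupp.linearCombination ℚ (fun _ => (1 : ℚ))

theorem epsY_single (a : YoungDiagram) : epsY (Finsupp.single a 1) = 1 := by simp [epsY]

theorem eps_ext {f g : YV →ₗ[ℚ] ℚ}
    (h : ∀ a, f (Finsupp.single a 1) = g (Finsupp.single a 1)) : f = g := by
  apply Finsupp.lhom_ext'
  intro a
  apply LinearMap.ext_ring
  exact h a

theorem eps_opS (S : YoungDiagram → Finset YoungDiagram) (a : YoungDiagram) :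
    epsY (opS S (Finsupp.single a 1)) = (S a).card := by
  rw [opS_single, map_sum]
  simp [epsY_single]

/-- The vacuum functional. -/
def lY : Module.End ℚ YV →ₗ[ℚ] ℚ :=
  epsY ∘ₗ LinearMap.applyₗ (Finsupp.single (⊥ : YoungDiagram) (1 : ℚ))

theorem lY_apply (f : Module.End ℚ YV) : lY f = epsY (f (Finsupp.single ⊥ 1)) := rfl

theorem eps_U (k : ℕ) : epsY ∘ₗ opU (k + 1) = epsY ∘ₗ opD (k + 1) + epsY ∘ₗ opU k := by
  classical
  apply eps_ext
  intro a
  rw [LinearMap.add_apply, LinearMap.comp_apply, LinearMap.comp_apply, LinearMap.comp_apply,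
    opU, opU, opD, eps_opS, eps_opS, eps_opS]
  have h := count_DU a a k k
  rw [Finset.filter_true_of_mem, Finset.filter_true_of_mem, Finset.filter_true_of_mem] at h
  · exact_mod_cast h
  · intro v hv; rw [mem_upS] at hv; rw [mem_dnS]; exact ⟨hv.1, by omega⟩
  · intro v hv; rw [mem_dnS] at hv; rw [mem_upS]; exact ⟨hv.1, by omega⟩
  · intro v hv; rw [mem_upS] at hv; rw [mem_dnS]; exact ⟨hv.1, by omega⟩

theorem yd_bot_transpose : (⊥ : YoungDiagram).transpose = ⊥ := by
  apply SetLike.ext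
  rintro ⟨i, j⟩
  simp

theorem opData : OpData opU opV opD opT lY where
  D0 := opD_zero
  U0 := opU_zero
  DU := op_DU
  UV := op_UV
  VU := op_VU
  lU k a := by
    have := LinearMap.congr_fun (eps_U k) (a (Finsupp.single ⊥ 1))
    simpa [lY_apply] using this
  lD k a := by
    rw [lY_apply, Module.End.mul_apply, opD, opS_single, show dnS (k + 1) ⊥ = ∅ from ?_]
    · simp
    · ext v
      rw [mem_dnS]
      simp [YoungDiagram.card]
  TV := opT_V
  lT a := by
    have : epsY ∘ₗ opT = epsY := by
      apply eps_ext; intro a; rw [LinearMap.comp_apply, opT_single, epsY_single, epsY_single]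
    exact LinearMap.congr_fun this (a (Finsupp.single ⊥ 1))
  lT' a := by
    rw [lY_apply, Module.End.mul_apply, opT_single, yd_bot_transpose]; rfl

end Ops


section Coeffs

variable {σ : Type*} [DecidableEq σ] {A : Type*} [Ring A]

/-- The ordered product `U (d (k-1)) * ... * U (d 0)`. -/
def opProd (U : ℕ → A) (d : ℕ → ℕ) : ℕ → A
  | 0 => 1
  | k + 1 => U (d k) * opProd U d k

/-- Clearing the exponents of `xs 0, ..., xs (k-1)`. -/
def clr (xs : ℕ → σ) : ℕ → (σ →₀ ℕ) → (σ →₀ ℕ)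
  | 0, d => d
  | k + 1, d => clr xs k (d.update (xs k) 0)

theorem clr_of_ne (xs : ℕ → σ) (k : ℕ) (d : σ →₀ ℕ) (t : σ) (h : ∀ i < k, xs i ≠ t) :
    clr xs k d t = d t := by
  induction k generalizing d with
  | zero => rfl
  | succ k ih =>
    rw [clr, ih _ (fun i hi => h i (by omega)), Finsupp.update_apply,
      if_neg (fun h' => h k (by omega) h'.symm)]

theorem clr_of_eq (xs : ℕ → σ) (k : ℕ) (d : σ →₀ ℕ) (t : σ) (h : d t = 0 ∨ ∃ i < k, xs i = t) :
    clr xs k d t = 0 := by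
  induction k generalizing d with
  | zero =>
    rcases h with h | ⟨i, hi, _⟩
    · exact h
    · omega
  | succ k ih =>
    rw [clr]
    apply ih
    by_cases hk : t = xs k
    · left; rw [Finsupp.update_apply, if_pos hk]
    rcases h with h | ⟨i, hi, h⟩
    · left; rw [Finsupp.update_apply, if_neg hk, h]
    · right
      refine ⟨i, ?_, h⟩
      rcases Nat.lt_succ_iff_lt_or_eq.1 hi with h' | h'
      · exact h'
      · subst h'; exact absurd h.symm hk

theorem opProd_congr (U : ℕ → A) (d e : ℕ → ℕ) (k : ℕ) (h : ∀ i < k, d i = e i) :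
    opProd U d k = opProd U e k := by
  induction k with
  | zero => rfl
  | succ k ih => rw [opProd, opProd, ih (fun i hi => h i (by omega)), h k (by omega)]

theorem coeff_PP_mul (U : ℕ → A) (xs : ℕ → σ) (F : MvPowerSeries σ A) (k : ℕ)
    (hx : ∀ i < k, ∀ j < i, xs i ≠ xs j)
    (hF : ∀ e : σ →₀ ℕ, (∃ i < k, e (xs i) ≠ 0) → MvPowerSeries.coeff e F = 0) (d : σ →₀ ℕ) :
    MvPowerSeries.coeff d (PP U xs k * F) =
      opProd U (fun i => d (xs i)) k * MvPowerSeries.coeff (clr xs k d) F := by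
  induction k generalizing d with
  | zero => simp [PP, opProd, clr]
  | succ k ih =>
    have ih' := ih (fun i hi => hx i (by omega))
      (fun e ⟨i, hi, he⟩ => hF e ⟨i, by omega, he⟩)
    rw [PP, mul_assoc, coeff_gen_mul]
    rw [Finset.sum_eq_single (d (xs k), 0)]
    · simp only
      rw [ih', opProd, clr, mul_assoc]
      congr 2
      apply opProd_congr
      intro i hi
      rw [Finsupp.update_apply, if_neg (fun h => hx k (by omega) i hi h.symm)]
    · rintro ⟨p, q⟩ hp hne
      rw [Finset.HasAntidiagonal.mem_antidiagonal] at hp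
      simp only at hp ⊢
      rw [ih', hF _ ⟨k, by omega, ?_⟩, mul_zero, mul_zero]
      rw [clr_of_ne _ _ _ _ (fun i hi h => hx k (by omega) i hi h.symm), Finsupp.update_apply,
        if_pos rfl]
      rintro rfl
      apply hne
      simp at hp
      rw [hp]
    · intro h
      exact absurd (by rw [Finset.HasAntidiagonal.mem_antidiagonal]; simp) h

theorem coeff_PP_PP (U V : ℕ → A) (xs ys : ℕ → σ) (m n : ℕ)
    (hx : ∀ i < m, ∀ j < i, xs i ≠ xs j) (hy : ∀ i < n, ∀ j < i, ys i ≠ ys j)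
    (hxy : ∀ i < m, ∀ j < n, xs i ≠ ys j)
    (hall : ∀ t, (∃ i < m, xs i = t) ∨ (∃ j < n, ys j = t)) (d : σ →₀ ℕ) :
    MvPowerSeries.coeff d (PP U xs m * PP V ys n) =
      opProd U (fun i => d (xs i)) m * opProd V (fun j => d (ys j)) n := by
  have h1 : ∀ e : σ →₀ ℕ, MvPowerSeries.coeff e (PP V ys n) =
      opProd V (fun j => e (ys j)) n * MvPowerSeries.coeff (clr ys n e) 1 := by
    intro e
    by_cases he : True
    · have hg : ∀ k ≤ n, ∀ e : σ →₀ ℕ, MvPowerSeries.coeff e (PP V ys k) =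
          opProd V (fun j => e (ys j)) k * MvPowerSeries.coeff (clr ys k e) 1 := by
        intro k hk e
        have := coeff_PP_mul V ys 1 k (fun i hi => hy i (by omega)) ?_ e
        · rwa [mul_one] at this
        · rintro e ⟨i, _, hi⟩
          rw [MvPowerSeries.coeff_one, if_neg]
          rintro rfl
          exact hi rfl
      exact hg n le_rfl e
    · exact absurd trivial he
  rw [coeff_PP_mul U xs _ m hx, h1, MvPowerSeries.coeff_one, if_pos, mul_one]
  · congr 1
    apply opProd_congr
    intro j hj
    exact clr_of_ne _ _ _ _ (fun i hi => hxy i hi j hj)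
  · ext t
    apply clr_of_eq
    rcases hall t with h | h
    · left; exact clr_of_eq _ _ _ _ (Or.inr h)
    · right; exact h
  · rintro e ⟨i, hi, he⟩
    rw [h1, MvPowerSeries.coeff_one, if_neg, mul_zero]
    intro h0
    apply he
    rw [← clr_of_ne ys n e (xs i) (fun j hj h => hxy i hi j hj h.symm), h0]; rfl

end Coeffs

section Tableaux

theorem opU_apply (k : ℕ) (v : YV) (b : YoungDiagram) : opU k v b = ∑ a ∈ dnS k b, v a := by
  classical
  induction v using Finsupp.induction_linear with
  | zero => simp
  | add f g hf hg => rw [map_add, Finsupp.add_apply, hf, hg, ← Finset.sum_add_distrib]; rfl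
  | single a c =>
    have : (Finsupp.single a c : YV) = c • Finsupp.single a 1 := by simp
    rw [this, map_smul, Finsupp.smul_apply, opU, opS_single_apply]
    simp only [Finsupp.smul_apply, Finsupp.single_apply, smul_eq_mul]
    rw [← Finset.mul_sum, Finset.sum_ite_eq]
    congr 1
    simp only [mem_upS, mem_dnS]
    congr 1
    rw [eq_comm (a := b.card)]

/-- Skew semistandard tableaux with given content. -/
def tabS (m : ℕ) (d : ℕ → ℕ) (lam tau : YoungDiagram) : Set (ℕ → ℕ → ℕ) :=
  {T | tau ≤ lam ∧ IsSkewSSYT m lam tau T ∧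
    ∀ k < m, d k = ((lam.cells \ tau.cells).filter fun c => T c.1 c.2 = k).card}

open Classical in
/-- Filling the cells of `lam` outside `kap` by `m`. -/
def extT (m : ℕ) (lam kap : YoungDiagram) (T : ℕ → ℕ → ℕ) : ℕ → ℕ → ℕ :=
  fun i j => if (i, j) ∈ lam ∧ (i, j) ∉ kap then m else T i j

theorem isSkew_iff (m : ℕ) (lam tau : YoungDiagram) (T : ℕ → ℕ → ℕ) :
    IsSkewSSYT m lam tau T ↔
  (∀ i j : ℕ, (i, j) ∈ lam → (i, j) ∉ tau → T i j < m) ∧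
  (∀ i j1 j2 : ℕ, j1 ≤ j2 → (i, j1) ∈ lam → (i, j1) ∉ tau →
      (i, j2) ∈ lam → (i, j2) ∉ tau → T i j1 ≤ T i j2) ∧
  (∀ i1 i2 j : ℕ, i1 < i2 → (i1, j) ∈ lam → (i1, j) ∉ tau →
      (i2, j) ∈ lam → (i2, j) ∉ tau → T i1 j < T i2 j) ∧
  (∀ i j : ℕ, ¬ ((i, j) ∈ lam ∧ (i, j) ∉ tau) → T i j = 0) := by
  simp only [IsSkewSSYT, Finset.mem_sdiff, YoungDiagram.mem_cells, and_imp]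

theorem yd_mem_of_le {a b : YoungDiagram} (h : a ≤ b) {c : ℕ × ℕ} (hc : c ∈ a) : c ∈ b := h hc

theorem extT_mem {m : ℕ} {d : ℕ → ℕ} {lam kap tau : YoungDiagram} {T : ℕ → ℕ → ℕ}
    (hk : kap ∈ dnS (d m) lam) (hT : T ∈ tabS m d kap tau) :
    extT m lam kap T ∈ tabS (m + 1) d lam tau := by
  classical
  obtain ⟨h1, h2⟩ := mem_dnS.1 hk
  obtain ⟨hle, hcol⟩ := hs_iff.1 h1
  obtain ⟨htk, hss, hcnt⟩ := hT
  rw [isSkew_iff] at hss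
  obtain ⟨ha, hb, hc, hd⟩ := hss
  refine ⟨htk.trans hle, ?_, ?_⟩
  · rw [isSkew_iff]
    refine ⟨?_, ?_, ?_, ?_⟩
    · intro i j hl ht
      unfold extT
      split_ifs with h
      · omega
      · have := ha i j (by tauto) ht; omega
    · intro i j1 j2 hj h1 h1' h2 h2'
      unfold extT
      have hdn : (i, j2) ∈ kap → (i, j1) ∈ kap := fun h => kap.up_left_mem le_rfl hj h
      by_cases k1 : (i, j1) ∈ kap
      · rw [if_neg (by tauto)]
        have := ha i j1 k1 h1'
        split_ifs with h
        · omega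
        · exact hb i j1 j2 hj k1 h1' (by tauto) h2'
      · rw [if_pos ⟨h1, k1⟩, if_pos ⟨h2, by tauto⟩]
    · intro i1 i2 j hi h1 h1' h2 h2'
      unfold extT
      have k1 : (i1, j) ∈ kap := hcol _ _ (lam.up_left_mem (by omega) le_rfl h2)
      rw [if_neg (by tauto)]
      have := ha i1 j k1 h1'
      split_ifs with h
      · exact this
      · exact hc i1 i2 j hi k1 h1' (by tauto) h2'
    · intro i j h
      unfold extT
      have e1 : (i, j) ∈ tau → (i, j) ∈ kap := fun h => yd_mem_of_le htk h
      have e2 : (i, j) ∈ kap → (i, j) ∈ lam := fun h => yd_mem_of_le hle h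
      rw [if_neg (by tauto)]
      exact hd i j (by tauto)
  · intro k hk
    rcases Nat.lt_succ_iff_lt_or_eq.1 hk with hk | rfl
    · rw [hcnt k hk]
      congr 1
      ext ⟨i, j⟩
      unfold extT
      rw [Finset.mem_filter, Finset.mem_filter]
      simp only [Finset.mem_sdiff, YoungDiagram.mem_cells]
      have e2 : (i, j) ∈ kap → (i, j) ∈ lam := fun h => yd_mem_of_le hle h
      split_ifs with h
      · constructor
        · tauto
        · rintro ⟨_, h⟩; omega
      · tauto
    · have : (lam.cells \ tau.cells).filter (fun c => extT k lam kap T c.1 c.2 = k)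
          = lam.cells \ kap.cells := by
        ext ⟨i, j⟩
        unfold extT
        rw [Finset.mem_filter]
        simp only [Finset.mem_sdiff, YoungDiagram.mem_cells]
        have e1 : (i, j) ∈ tau → (i, j) ∈ kap := fun h => yd_mem_of_le htk h
        split_ifs with h
        · tauto
        · constructor
          · rintro ⟨⟨u, v⟩, w⟩
            have := ha i j (by tauto) v
            omega
          · tauto
      rw [this, Finset.card_sdiff_of_subset (YoungDiagram.cells_subset_iff.2 hle)]
      change _ = lam.card - kap.card
      omega

theorem extT_surj {m : ℕ} {d : ℕ → ℕ} {lam tau : YoungDiagram} {T : ℕ → ℕ → ℕ}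
    (hT : T ∈ tabS (m + 1) d lam tau) :
    ∃ kap ∈ dnS (d m) lam, ∃ T' ∈ tabS m d kap tau, extT m lam kap T' = T := by
  classical
  obtain ⟨htl, hss, hcnt⟩ := hT
  rw [isSkew_iff] at hss
  obtain ⟨ha, hb, hc, hd⟩ := hss
  let kap : YoungDiagram :=
    { cells := tau.cells ∪ (lam.cells \ tau.cells).filter (fun c => T c.1 c.2 < m)
      isLowerSet := by
        rintro ⟨i, j⟩ ⟨i', j'⟩ hle hm
        obtain ⟨hi, hj⟩ := Prod.mk_le_mk.1 hle
        simp only [Finset.coe_union, Set.mem_union, Finset.mem_coe, Finset.mem_filter,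
          Finset.mem_sdiff, YoungDiagram.mem_cells] at hm ⊢
        rcases hm with hm | ⟨⟨h1, h2⟩, h3⟩
        · left; exact tau.up_left_mem hi hj hm
        · by_cases ht : (i', j') ∈ tau
          · left; exact ht
          · right
            have ht' : (i', j) ∉ tau := fun h => ht (tau.up_left_mem le_rfl hj h)
            have hl' : (i', j) ∈ lam := lam.up_left_mem hi le_rfl h1
            have hl'' : (i', j') ∈ lam := lam.up_left_mem hi hj h1
            refine ⟨⟨hl'', ht⟩, ?_⟩
            have e1 := hb i' j' j hj hl'' ht hl' ht'
            rcases hi.lt_or_eq with hi | rfl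
            · have := hc i' i j hi hl' ht' h1 h2
              omega
            · omega }
  have mk : ∀ i j, (i, j) ∈ kap ↔ (i, j) ∈ tau ∨ (((i, j) ∈ lam ∧ (i, j) ∉ tau) ∧ T i j < m) := by
    intro i j
    rw [← YoungDiagram.mem_cells]
    simp only [kap, Finset.mem_union, Finset.mem_filter, Finset.mem_sdiff, YoungDiagram.mem_cells]
  have htl' : ∀ i j, (i, j) ∈ tau → (i, j) ∈ lam := fun i j h => yd_mem_of_le htl h
  have hkl : kap ≤ lam := by
    rintro ⟨i, j⟩ h
    have h := (mk i j).1 h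
    have := htl' i j
    change (i, j) ∈ lam
    tauto
  have htk : tau ≤ kap := by
    rintro ⟨i, j⟩ h
    exact (mk i j).2 (Or.inl h)
  have hcard : kap.card + d m = lam.card := by
    have : (lam.cells \ tau.cells).filter (fun c => T c.1 c.2 = m)
          = lam.cells \ kap.cells := by
      ext ⟨i, j⟩
      simp only [Finset.mem_filter, Finset.mem_sdiff, YoungDiagram.mem_cells, mk]
      have := ha i j
      constructor
      · rintro ⟨⟨u, v⟩, w⟩
        refine ⟨u, ?_⟩
        rintro (h | h)
        · exact v h
        · omega
      · rintro ⟨u, v⟩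
        have v1 : (i, j) ∉ tau := fun h => v (Or.inl h)
        have v2 : ¬ T i j < m := fun h => v (Or.inr ⟨⟨u, v1⟩, h⟩)
        have := ha i j u v1
        exact ⟨⟨u, v1⟩, by omega⟩
    have h := hcnt m (by omega)
    rw [this, Finset.card_sdiff_of_subset (YoungDiagram.cells_subset_iff.2 hkl)] at h
    change _ = lam.card - kap.card at h
    have h' : kap.card ≤ lam.card := Finset.card_le_card (YoungDiagram.cells_subset_iff.2 hkl)
    omega
  refine ⟨kap, mem_dnS.2 ⟨hs_iff.2 ⟨hkl, ?_⟩, hcard⟩,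
    fun i j => if (i, j) ∈ kap then T i j else 0, ⟨htk, ?_, ?_⟩, ?_⟩
  · intro i j h
    have hl : (i, j) ∈ lam := lam.up_left_mem (by omega) le_rfl h
    rw [mk]
    by_cases ht : (i, j) ∈ tau
    · left; exact ht
    · right
      have ht' : (i + 1, j) ∉ tau := fun h => ht (tau.up_left_mem (by omega) le_rfl h)
      have e1 := hc i (i + 1) j (by omega) hl ht h ht'
      have e2 := ha (i + 1) j h ht'
      exact ⟨⟨hl, ht⟩, by omega⟩
  · rw [isSkew_iff]
    refine ⟨?_, ?_, ?_, ?_⟩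
    · intro i j hk ht
      simp only [if_pos hk]
      have := (mk i j).1 hk
      tauto
    · intro i j1 j2 hj h1 h1' h2 h2'
      simp only [if_pos h1, if_pos h2]
      exact hb i j1 j2 hj (yd_mem_of_le hkl h1) h1' (yd_mem_of_le hkl h2) h2'
    · intro i1 i2 j hi h1 h1' h2 h2'
      simp only [if_pos h1, if_pos h2]
      exact hc i1 i2 j hi (yd_mem_of_le hkl h1) h1' (yd_mem_of_le hkl h2) h2'
    · intro i j h
      split_ifs with hk
      · apply hd
        have : (i, j) ∈ kap → (i, j) ∈ lam := fun h => yd_mem_of_le hkl h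
        tauto
      · rfl
  · intro k hk
    rw [hcnt k (by omega)]
    congr 1
    ext ⟨i, j⟩
    simp only [Finset.mem_filter, Finset.mem_sdiff, YoungDiagram.mem_cells]
    constructor
    · rintro ⟨⟨u, v⟩, w⟩
      have : (i, j) ∈ kap := (mk i j).2 (Or.inr ⟨⟨u, v⟩, by omega⟩)
      exact ⟨⟨this, v⟩, by rw [if_pos this, w]⟩
    · rintro ⟨⟨u, v⟩, w⟩
      rw [if_pos u] at w
      exact ⟨⟨yd_mem_of_le hkl u, v⟩, w⟩
  · funext i j
    unfold extT
    by_cases h1 : (i, j) ∈ lam ∧ (i, j) ∉ kap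
    · rw [if_pos h1]
      have h3 := h1.2
      rw [mk] at h3
      have v1 : (i, j) ∉ tau := fun h => h3 (Or.inl h)
      have v2 : ¬ T i j < m := fun h => h3 (Or.inr ⟨⟨h1.1, v1⟩, h⟩)
      have := ha i j h1.1 v1
      omega
    · rw [if_neg h1]
      change (if (i, j) ∈ kap then T i j else 0) = T i j
      split_ifs with h2
      · rfl
      · symm
        apply hd
        tauto

theorem extT_inj {m : ℕ} {d : ℕ → ℕ} {lam kap kap' tau : YoungDiagram} {T T' : ℕ → ℕ → ℕ}
    (hk : kap ∈ dnS (d m) lam) (hT : T ∈ tabS m d kap tau)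
    (hk' : kap' ∈ dnS (d m) lam) (hT' : T' ∈ tabS m d kap' tau)
    (h : extT m lam kap T = extT m lam kap' T') : kap = kap' ∧ T = T' := by
  classical
  have key : ∀ {kap : YoungDiagram} {T : ℕ → ℕ → ℕ}, kap ∈ dnS (d m) lam → T ∈ tabS m d kap tau →
      ∀ i j, (i, j) ∈ kap ↔ (i, j) ∈ tau ∨ ((i, j) ∈ lam ∧ extT m lam kap T i j < m) := by
    intro kap T hk hT i j
    obtain ⟨h1, h2⟩ := mem_dnS.1 hk
    obtain ⟨htk, hss, hcnt⟩ := hT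
    rw [isSkew_iff] at hss
    constructor
    · intro h
      by_cases ht : (i, j) ∈ tau
      · exact Or.inl ht
      · refine Or.inr ⟨yd_mem_of_le h1.le h, ?_⟩
        rw [extT, if_neg (by tauto)]
        exact hss.1 i j h ht
    · rintro (h | ⟨h, h'⟩)
      · exact yd_mem_of_le htk h
      · by_contra hc
        rw [extT, if_pos ⟨h, hc⟩] at h'
        omega
  have hkk : kap = kap' := by
    apply YoungDiagram.ext
    ext ⟨i, j⟩
    rw [YoungDiagram.mem_cells, YoungDiagram.mem_cells, key hk hT, key hk' hT', h]
  subst hkk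
  refine ⟨rfl, ?_⟩
  funext i j
  have e := congrFun (congrFun h i) j
  unfold extT at e
  split_ifs at e with hc
  · have h1 := hT.2.1
    have h2 := hT'.2.1
    rw [isSkew_iff] at h1 h2
    rw [h1.2.2.2 i j (by tauto), h2.2.2.2 i j (by tauto)]
  · exact e

theorem tab_count (m : ℕ) (d : ℕ → ℕ) (lam tau : YoungDiagram) :
    (tabS m d lam tau).Finite ∧
      ((tabS m d lam tau).ncard : ℚ) = opProd opU d m (Finsupp.single tau 1) lam := by
  classical
  induction m generalizing lam with
  | zero =>
    have hs : tabS 0 d lam tau = if tau = lam then {fun _ _ => 0} else ∅ := by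
      ext T
      split_ifs with h
      · subst h
        rw [Set.mem_singleton_iff]
        constructor
        · rintro ⟨_, h, _⟩
          rw [isSkew_iff] at h
          funext i j
          exact h.2.2.2 i j (by tauto)
        · rintro rfl
          refine ⟨le_rfl, ?_, by intro k hk; omega⟩
          rw [isSkew_iff]
          refine ⟨?_, ?_, ?_, ?_⟩ <;> intros <;> first | rfl | tauto
      · simp only [Set.mem_empty_iff_false, iff_false]
        rintro ⟨h1, h2, _⟩
        apply h
        apply le_antisymm h1
        rintro ⟨i, j⟩ hl
        by_contra hc
        exact absurd (((isSkew_iff _ _ _ _).1 h2).1 i j hl hc) (by omega)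
    rw [hs, opProd, Module.End.one_apply, Finsupp.single_apply]
    split_ifs <;> simp
  | succ m ih =>
    have hs : tabS (m + 1) d lam tau = ((dnS (d m) lam).biUnion
        (fun kap => ((ih kap).1.toFinset.image (extT m lam kap))) : Finset (ℕ → ℕ → ℕ)) := by
      ext T
      simp only [Finset.coe_biUnion, Set.mem_iUnion, Finset.coe_image, Set.Finite.coe_toFinset,
        Set.mem_image, Finset.mem_coe, exists_prop]
      constructor
      · exact extT_surj
      · rintro ⟨kap, hk, T', hT', rfl⟩
        exact extT_mem hk hT'
    refine ⟨hs ▸ Finset.finite_toSet _, ?_⟩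
    rw [hs, Set.ncard_coe_finset, Finset.card_biUnion, opProd, Module.End.mul_apply, opU_apply,
      Nat.cast_sum]
    · apply Finset.sum_congr rfl
      intro kap hk
      refine Eq.trans ?_ (ih kap).2
      rw [Finset.card_image_of_injOn, ← Set.ncard_eq_toFinset_card _ (ih kap).1]
      intro T hT T' hT' h
      simp only [Set.Finite.coe_toFinset] at hT hT'
      exact (extT_inj hk hT hk hT' h).2
    · intro kap hk kap' hk' hne
      rw [Function.onFun, Finset.disjoint_left]
      intro S h1 h2
      simp only [Finset.mem_image, Set.Finite.mem_toFinset] at h1 h2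
      obtain ⟨T, hT, rfl⟩ := h1
      obtain ⟨T', hT', h⟩ := h2
      exact hne (extT_inj hk' hT' hk hT h).1.symm

theorem opT_prod (d : ℕ → ℕ) (n : ℕ) : opT * opProd opV d n = opProd opU d n * opT := by
  induction n with
  | zero => simp [opProd]
  | succ n ih => rw [opProd, opProd, ← mul_assoc, opT_V, mul_assoc, ih, mul_assoc]

theorem prodV_apply (d : ℕ → ℕ) (n : ℕ) (tau : YoungDiagram) :
    opProd opV d n (Finsupp.single ⊥ 1) tau = opProd opU d n (Finsupp.single ⊥ 1) tau.transpose := by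
  have h := congrArg (fun f : Module.End ℚ YV => f (Finsupp.single ⊥ 1) tau.transpose) (opT_prod d n)
  simp only [Module.End.mul_apply, opT_single, yd_bot_transpose] at h
  rw [← h]
  rw [opT, Finsupp.lmapDomain_apply, Finsupp.mapDomain_apply]
  intro a b hab
  rw [← a.transpose_transpose, ← b.transpose_transpose]
  exact congrArg _ hab

theorem end_expand (f : Module.End ℚ YV) (v : YV) (b : YoungDiagram) (S : Finset YoungDiagram)
    (hS : ∀ a, a ∉ S → f (Finsupp.single a 1) b = 0) :
    f v b = ∑ a ∈ S, f (Finsupp.single a 1) b * v a := by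
  classical
  induction v using Finsupp.induction_linear with
  | zero => simp
  | add g h hg hh =>
    rw [map_add, Finsupp.add_apply, hg, hh, ← Finset.sum_add_distrib]
    apply Finset.sum_congr rfl
    intro a _
    rw [Finsupp.add_apply, mul_add]
  | single a c =>
    have : (Finsupp.single a c : YV) = c • Finsupp.single a 1 := by simp
    rw [this, map_smul, Finsupp.smul_apply]
    simp only [Finsupp.smul_apply, Finsupp.single_apply, smul_eq_mul, mul_ite, mul_one, mul_zero]
    rw [Finset.sum_ite_eq]
    split_ifs with h
    · ring
    · rw [hS a h, mul_zero]

theorem ssc_eq (m n : ℕ) (lam : YoungDiagram) (d : (Fin m ⊕ Fin n) →₀ ℕ) (dx dy : ℕ → ℕ)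
    (hdx : ∀ k : Fin m, d (Sum.inl k) = dx k) (hdy : ∀ k : Fin n, d (Sum.inr k) = dy k) :
    (superSchurCoeff m n lam d : ℚ) =
      (opProd opU dx m * opProd opV dy n) (Finsupp.single ⊥ 1) lam := by
  classical
  have hs : {t : YoungDiagram × (ℕ → ℕ → ℕ) × (ℕ → ℕ → ℕ) |
    t.1 ≤ lam ∧ IsSkewSSYT m lam t.1 t.2.1 ∧
    IsSkewSSYT n t.1.transpose ⊥ t.2.2 ∧
    (∀ k : Fin m, d (Sum.inl k)
        = ((lam.cells \ t.1.cells).filter fun c => t.2.1 c.1 c.2 = k.val).card) ∧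
    (∀ k : Fin n, d (Sum.inr k)
        = ((t.1.transpose.cells \ (⊥ : YoungDiagram).cells).filter
            fun c => t.2.2 c.1 c.2 = k.val).card)} =
      (((upTo lam.card).biUnion fun tau => ((tab_count m dx lam tau).1.toFinset ×ˢ
        (tab_count n dy tau.transpose ⊥).1.toFinset).image (fun p => (tau, p)) :
          Finset (YoungDiagram × (ℕ → ℕ → ℕ) × (ℕ → ℕ → ℕ)))) := by
    ext ⟨tau, T, T'⟩
    simp only [Set.mem_setOf_eq, Finset.coe_biUnion, Set.mem_iUnion, Finset.coe_image,
      Set.mem_image, Finset.mem_coe, exists_prop, Finset.mem_product, Set.Finite.mem_toFinset,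
      mem_upTo, hdx, hdy]
    constructor
    · rintro ⟨h1, h2, h3, h4, h5⟩
      refine ⟨tau, Finset.card_le_card (YoungDiagram.cells_subset_iff.2 h1), (T, T'),
        ⟨⟨h1, h2, fun k hk => h4 ⟨k, hk⟩⟩, ⟨bot_le, h3, fun k hk => h5 ⟨k, hk⟩⟩⟩, rfl⟩
    · rintro ⟨tau', h0, ⟨p, p'⟩, ⟨⟨h1, h2, h3⟩, ⟨h4, h5, h6⟩⟩, he⟩
      simp only [Prod.mk.injEq] at he
      obtain ⟨rfl, rfl, rfl⟩ := he
      exact ⟨h1, h2, h5, fun k => h3 k k.2, fun k => h6 k k.2⟩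
  rw [superSchurCoeff, hs, Set.ncard_coe_finset, Finset.card_biUnion, Module.End.mul_apply,
    end_expand _ _ _ (upTo lam.card), Nat.cast_sum]
  · apply Finset.sum_congr rfl
    intro tau _
    rw [Finset.card_image_of_injective _ (Prod.mk_right_injective tau), Finset.card_product,
      ← Set.ncard_eq_toFinset_card _ (tab_count m dx lam tau).1,
      ← Set.ncard_eq_toFinset_card _ (tab_count n dy tau.transpose ⊥).1, Nat.cast_mul,
      (tab_count m dx lam tau).2, (tab_count n dy tau.transpose ⊥).2, prodV_apply]
  · intro a ha
    rw [← (tab_count m dx lam a).2]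
    have : tabS m dx lam a = ∅ := by
      ext T
      simp only [Set.mem_empty_iff_false, iff_false]
      rintro ⟨h, _⟩
      exact ha (mem_upTo.2 (Finset.card_le_card (YoungDiagram.cells_subset_iff.2 h)))
    rw [this]; simp
  · intro a _ b _ hne
    rw [Function.onFun, Finset.disjoint_left]
    intro S h1 h2
    simp only [Finset.mem_image] at h1 h2
    obtain ⟨p, _, rfl⟩ := h1
    obtain ⟨q, _, h⟩ := h2
    exact hne (Prod.ext_iff.1 h).1.symm

theorem strict_bound (f : ℕ → ℕ) (N M : ℕ) (h : ∀ a b, a < b → b ≤ N → f a < f b) (hN : f N < M) :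
    N < M := by
  have : ∀ k ≤ N, k ≤ f k := by
    intro k
    induction k with
    | zero => intro _; omega
    | succ k ih => intro hk; have := h k (k + 1) (by omega) hk; have := ih (by omega); omega
  have := this N le_rfl
  omega

theorem ssc_hook (m n : ℕ) (lam : YoungDiagram) (d : (Fin m ⊕ Fin n) →₀ ℕ)
    (hl : ¬ lam.rowLen m ≤ n) : superSchurCoeff m n lam d = 0 := by
  rw [superSchurCoeff]
  refine (congrArg Set.ncard ?_).trans (Set.ncard_empty (YoungDiagram × (ℕ → ℕ → ℕ) × (ℕ → ℕ → ℕ)))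
  ext ⟨tau, T, T'⟩
  simp only [Set.mem_setOf_eq, Set.mem_empty_iff_false, iff_false]
  rintro ⟨h1, h2, h3, -, -⟩
  rw [isSkew_iff] at h2 h3
  have hb : ∀ c : ℕ × ℕ, c ∉ (⊥ : YoungDiagram) := fun c => YoungDiagram.notMem_bot c
  have hml : (m, n) ∈ lam := YoungDiagram.mem_iff_lt_rowLen.2 (by omega)
  have h0 : (0, n) ∉ tau := by
    intro h
    have h' : (n, 0) ∈ tau.transpose := by simpa [YoungDiagram.mem_transpose] using h
    have := strict_bound (fun i => T' i 0) n n ?_ (h3.1 n 0 h' (hb _))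
    · omega
    · intro a b hab hbn
      exact h3.2.2.1 a b 0 hab (tau.transpose.up_left_mem (by omega) le_rfl h') (hb _)
        (tau.transpose.up_left_mem (by omega) le_rfl h') (hb _)
  have hk : ∀ i, (i, n) ∉ tau := fun i h => h0 (tau.up_left_mem (by omega) le_rfl h)
  have := strict_bound (fun i => T i n) m m ?_ (h2.1 m n hml (hk _))
  · omega
  · intro a b hab hbn
    exact h2.2.2.1 a b n hab (lam.up_left_mem (by omega) le_rfl hml) (hk _)
      (lam.up_left_mem (by omega) le_rfl hml) (hk _)

theorem epsY_tsum (v : YV) : ∑' a, v a = epsY v := by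
  rw [tsum_eq_sum (s := v.support) (fun a ha => by simpa using ha), epsY,
    Finsupp.linearCombination_apply, Finsupp.sum]
  simp

theorem sum_eq_phi (m n : ℕ) (xs ys : ℕ → Fin m ⊕ Fin n)
    (hxs : ∀ i : Fin m, xs i = Sum.inl i) (hys : ∀ i : Fin n, ys i = Sum.inr i)
    (hx : ∀ i < m, ∀ j < i, xs i ≠ xs j) (hy : ∀ i < n, ∀ j < i, ys i ≠ ys j)
    (hxy : ∀ i < m, ∀ j < n, xs i ≠ ys j) :
    superSchurSum m n {lam : YoungDiagram | lam.rowLen m ≤ n} (fun _ => 1) =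
      phi lY (PP opU xs m * PP opV ys n) := by
  ext d
  rw [coeff_phi, coeff_PP_PP opU opV xs ys m n hx hy hxy, lY_apply, ← epsY_tsum]
  · change (∑' lam : {lam : YoungDiagram | lam.rowLen m ≤ n},
      (1 : ℚ) * (superSchurCoeff m n (lam : YoungDiagram) d : ℚ)) = _
    simp only [one_mul]
    rw [tsum_subtype {lam : YoungDiagram | lam.rowLen m ≤ n}
      (fun lam => (superSchurCoeff m n lam d : ℚ))]
    congr 1
    funext lam
    rw [← ssc_eq m n lam d _ _ (fun k => by rw [hxs]) (fun k => by rw [hys])]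
    rw [Set.indicator_apply]
    split_ifs with h
    · rfl
    · rw [ssc_hook m n lam d h]; simp
  · rintro (i | j)
    · left; exact ⟨i, i.2, hxs i⟩
    · right; exact ⟨j, j.2, hys j⟩

theorem pairs_prod {R : Type*} [CommRing R] (m : ℕ) (x : ℕ → R) :
    (∏ q ∈ Finset.univ.filter (fun q : Fin m × Fin m => q.1 < q.2), (1 - x q.1 * x q.2)) =
      ∏ i ∈ Finset.range m, ∏ k ∈ Finset.range i, (1 - x i * x k) := by
  rw [Finset.prod_sigma']
  symm
  refine Finset.prod_bij' (fun p hp => (⟨p.2, ?_⟩, ⟨p.1, ?_⟩)) (fun q _ => ⟨q.2, q.1⟩) ?_ ?_ ?_ ?_ ?_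
  · simp at hp; omega
  · simp at hp; omega
  · intro p hp; simp at hp; simp [hp]
  · intro q hq; simp at hq; simp [hq]
  · intro p hp; rfl
  · intro q hq; rfl
  · intro p hp; simp [mul_comm]

end Tableaux


open MvPowerSeries

/-- Cummins–King: in ℚ[[x_1,…,x_m,y_1,…,y_n]],
`∏_{i,j}(1+x_i y_j) = ∏_i(1-x_i) ∏_{i<k}(1-x_i x_k) ∏_j(1-y_j) ∏_{j<l}(1-y_j y_l)
  · Σ_{λ ∈ H} s_λ(x|y)`,
the sum running over all partitions `λ` in the `(m|n)`-hook (`λ_{m+1} ≤ n`). -/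
theorem cummins_king (m n : ℕ) (hm : 0 < m) (hn : 0 < n) :
    (∏ ij : Fin m × Fin n, (1 + X (Sum.inl ij.1) * X (Sum.inr ij.2)))
    = (∏ i : Fin m, (1 - X (Sum.inl i)))
      * (∏ ik ∈ Finset.univ.filter (fun q : Fin m × Fin m => q.1 < q.2),
          (1 - X (Sum.inl ik.1) * X (Sum.inl ik.2)))
      * (∏ j : Fin n, (1 - X (Sum.inr j)))
      * (∏ jl ∈ Finset.univ.filter (fun q : Fin n × Fin n => q.1 < q.2),
          (1 - X (Sum.inr jl.1) * X (Sum.inr jl.2)))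
      * superSchurSum m n {lam : YoungDiagram | lam.rowLen m ≤ n} (fun _ => 1) := by
  have := hm
  let xs : ℕ → Fin m ⊕ Fin n := fun i => if h : i < m then Sum.inl ⟨i, h⟩ else Sum.inl ⟨0, hm⟩
  let ys : ℕ → Fin m ⊕ Fin n := fun i => if h : i < n then Sum.inr ⟨i, h⟩ else Sum.inr ⟨0, hn⟩
  have hxs' : ∀ i (h : i < m), xs i = Sum.inl ⟨i, h⟩ := fun i h => dif_pos h
  have hys' : ∀ i (h : i < n), ys i = Sum.inr ⟨i, h⟩ := fun i h => dif_pos h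
  have hxs : ∀ i : Fin m, xs i = Sum.inl i := fun i => hxs' i i.2
  have hys : ∀ i : Fin n, ys i = Sum.inr i := fun i => hys' i i.2
  have hx : ∀ i < m, ∀ j < i, xs i ≠ xs j := by
    intro i hi j hj
    rw [hxs' i hi, hxs' j (by omega)]
    simp; omega
  have hy : ∀ i < n, ∀ j < i, ys i ≠ ys j := by
    intro i hi j hj
    rw [hys' i hi, hys' j (by omega)]
    simp; omega
  have hxy : ∀ i < m, ∀ j < n, xs i ≠ ys j := by
    intro i hi j hj
    rw [hxs' i hi, hys' j hj]
    simp
  have hl : lY 1 = 1 := by rw [lY_apply, Module.End.one_apply, epsY_single]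
  have key := phi_final opData hl xs ys m n hx hy hxy
  rw [sum_eq_phi m n xs ys hxs hys hx hy hxy]
  have e1 : (∏ ij : Fin m × Fin n, (1 + X (Sum.inl ij.1) * X (Sum.inr ij.2)) :
      MvPowerSeries (Fin m ⊕ Fin n) ℚ) =
      ∏ i ∈ Finset.range m, ∏ j ∈ Finset.range n, (1 + X (xs i) * X (ys j)) := by
    rw [Fintype.prod_prod_type, ← Fin.prod_univ_eq_prod_range
      (fun i => ∏ j ∈ Finset.range n, (1 + X (xs i) * X (ys j) : MvPowerSeries (Fin m ⊕ Fin n) ℚ))]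
    apply Finset.prod_congr rfl
    intro i _
    rw [← Fin.prod_univ_eq_prod_range
      (fun j => (1 + X (xs i) * X (ys j) : MvPowerSeries (Fin m ⊕ Fin n) ℚ))]
    simp only [hxs, hys]
  have e2 := pairs_prod m (fun i => (X (xs i) : MvPowerSeries (Fin m ⊕ Fin n) ℚ))
  have e3 := pairs_prod n (fun i => (X (ys i) : MvPowerSeries (Fin m ⊕ Fin n) ℚ))
  have e4 := Fin.prod_univ_eq_prod_range
    (fun i => (1 - X (xs i) : MvPowerSeries (Fin m ⊕ Fin n) ℚ)) m
  have e5 := Fin.prod_univ_eq_prod_range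
    (fun i => (1 - X (ys i) : MvPowerSeries (Fin m ⊕ Fin n) ℚ)) n
  simp only [hxs] at e2 e4
  simp only [hys] at e3 e5
  rw [e1, e2, e3, e4, e5, ← key, Finset.prod_mul_distrib, Finset.prod_mul_distrib]
  ring

end
end

section
/- If a partition λ violates the (m|n)-hook condition, i.e. λ_{m+1} > n, then its supersymmetric Schur function in m+n variables vanishes: s_λ(x_1,…,x_m | y_1,…,y_n) = 0 in ℚ[[x_1,…,x_m,y_1,…,y_n]]. -/
noncomputable section

/-- if a partition violates the `(m|n)`-hook condition, i.e.
`λ_{m+1} > n`, then its supersymmetric Schur function in `m+n` variables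
vanishes: `s_λ(x_1,…,x_m|y_1,…,y_n) = 0`. -/
theorem superSchur_eq_zero_of_not_hook (m n : ℕ) (hm : 0 < m) (hn : 0 < n)
    (lam : YoungDiagram) (h : n < lam.rowLen m) :
    superSchur m n lam = 0 := by
  have hmn : (m, n) ∈ lam := YoungDiagram.mem_iff_lt_rowLen.2 h
  funext d
  show (superSchurCoeff m n lam d : ℚ) = 0
  rw [Nat.cast_eq_zero]
  unfold superSchurCoeff
  refine Eq.trans (congrArg Set.ncard ?_) (Set.ncard_empty _)
  rw [Set.eq_empty_iff_forall_notMem]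
  rintro ⟨tau, T, U⟩ ⟨_, ⟨hT1, _, hT3, _⟩, ⟨hU1, _, hU3, _⟩, _, _⟩
  dsimp only at hT1 hT3 hU1 hU3
  have key : (0, n) ∉ tau := by
    intro h0
    have mem : ∀ i, i ≤ n → (i, 0) ∈ tau.transpose.cells \ (⊥ : YoungDiagram).cells := by
      intro i hi
      simp only [YoungDiagram.cells_bot, Finset.sdiff_empty, YoungDiagram.mem_cells,
        YoungDiagram.mem_transpose]
      exact tau.up_left_mem le_rfl hi h0
    have ge : ∀ i, i ≤ n → i ≤ U i 0 := by
      intro i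
      induction i with
      | zero => intro _; exact Nat.zero_le _
      | succ k ih =>
        intro hk
        have := hU3 k (k + 1) 0 (Nat.lt_succ_self k) (mem k (by omega)) (mem (k + 1) hk)
        have := ih (by omega)
        omega
    have := hU1 n 0 (mem n le_rfl)
    have := ge n le_rfl
    omega
  have mem : ∀ i, i ≤ m → (i, n) ∈ lam.cells \ tau.cells := by
    intro i hi
    rw [Finset.mem_sdiff, YoungDiagram.mem_cells, YoungDiagram.mem_cells]
    exact ⟨lam.up_left_mem hi le_rfl hmn, fun hc => key (tau.up_left_mem (Nat.zero_le i) le_rfl hc)⟩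
  have ge : ∀ i, i ≤ m → i ≤ T i n := by
    intro i
    induction i with
    | zero => intro _; exact Nat.zero_le _
    | succ k ih =>
      intro hk
      have := hT3 k (k + 1) n (Nat.lt_succ_self k) (mem k (by omega)) (mem (k + 1) hk)
      have := ih (by omega)
      omega
  have := hT1 m n (mem m le_rfl)
  have := ge m le_rfl
  omega

end
end
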